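/- Let H be a virtually almost coherent standard (1,1) diagram and let s be a class of intersection points such that the lift β̃_s contains the two inconsistent arcs. Then in each of the upper and the lower half-plane, the line α̃ cuts β̃_s into at least two compact arcs. (Lemma 3.8 / 'corner case' lemma of the paper.) -/

import Mathlib

/-!
Common combinatorial framework for standard (1,1) diagrams in Rasmussen standard
form, their lifts to the universal cover of the torus, and the combinatorial knot
Floer chain complexes they define.
-/

namespace OneOneKnot

open scoped Classical

noncomputable section

/-- A state in the traversal of the lifts of the `β` curve of a standard (1,1) diagram
to the universal cover `ℝ²` of the torus.  `pos` is the position coordinate of an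
intersection point of `β` with a lift of `α`; `up` records whether `β` crosses that
lift of `α` upwards (with respect to the reference orientation of `β`); `top` records
whether `pos` is measured as a top-edge or a bottom-edge coordinate of the
corresponding fundamental rectangle; `ht` is the index of the lift of `α` (the line
`y = ht`). -/
structure CState where
  pos : ℤ
  up : Bool
  top : Bool
  ht : ℤ

/-- The data of a standard (1,1) diagram in Rasmussen standard form, encoded by a
four-tuple `(p, q, r, s)` with `q, r ≥ 0`, `2q + r ≤ p` and `0 ≤ s < p`. -/
structure StdDiagram where
  p : ℕ
  q : ℕ
  r : ℕ
  s : ℕ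
  hp : 0 < p
  h2qr : 2 * q + r ≤ p
  hs : s < p

namespace StdDiagram

variable (D : StdDiagram)

def pz : ℤ := D.p
def qz : ℤ := D.q
def rz : ℤ := D.r
def sz : ℤ := D.s

/-- One step forward along (a lift of) `β`, with respect to a reference orientation of
`β`.  This is Algorithm 1 of the paper: rainbow arcs occupy top-edge positions
`r, …, r + 2q - 1` and bottom-edge positions `0, …, 2q - 1` (mod `p`), the `i`-th
point of the top edge is identified with the `(i+s)`-th point of the bottom edge, and
`ht` records the line `y = ht` of the universal cover on which the point lies. -/
def step (σ : CState) : CState :=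
  let m := σ.pos % D.pz
  if σ.top then
    if σ.up then ⟨σ.pos + D.sz, σ.up, false, σ.ht⟩
    else if m ≤ D.rz - 1 then ⟨σ.pos + 2 * D.qz, σ.up, false, σ.ht - 1⟩
    else if m ≤ D.rz + 2 * D.qz - 1 then
      ⟨2 * D.rz + 2 * D.qz - 1 - 2 * m + σ.pos, true, true, σ.ht⟩
    else ⟨σ.pos, σ.up, false, σ.ht - 1⟩
  else
    if σ.up = false then ⟨σ.pos - D.sz, σ.up, true, σ.ht⟩
    else if m ≤ 2 * D.qz - 1 then ⟨2 * D.qz - 1 - 2 * m + σ.pos, false, false, σ.ht⟩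
    else if m ≤ D.rz + 2 * D.qz - 1 then ⟨σ.pos - 2 * D.qz, σ.up, true, σ.ht + 1⟩
    else ⟨σ.pos, σ.up, true, σ.ht + 1⟩

/-- One step backward along `β` (the inverse of `step`). -/
def stepB (σ : CState) : CState :=
  let m := σ.pos % D.pz
  if σ.top then
    if σ.up then
      if D.rz ≤ m ∧ m ≤ D.rz + 2 * D.qz - 1 then
        ⟨2 * D.rz + 2 * D.qz - 1 - 2 * m + σ.pos, false, true, σ.ht⟩
      else if m ≤ D.rz - 1 then ⟨σ.pos + 2 * D.qz, true, false, σ.ht - 1⟩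
      else ⟨σ.pos, true, false, σ.ht - 1⟩
    else ⟨σ.pos + D.sz, false, false, σ.ht⟩
  else
    if σ.up then ⟨σ.pos - D.sz, true, true, σ.ht⟩
    else
      if m ≤ 2 * D.qz - 1 then ⟨2 * D.qz - 1 - 2 * m + σ.pos, true, false, σ.ht⟩
      else if m ≤ 2 * D.qz + D.rz - 1 then ⟨σ.pos - 2 * D.qz, false, true, σ.ht + 1⟩
      else ⟨σ.pos, false, true, σ.ht + 1⟩

/-- Reference starting state: the intersection point with top-edge coordinate `0`
on the line `y = 0`. -/
def start0 : CState := ⟨0, false, true, 0⟩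

/-- `β` is a single closed curve: its traversal passes through all `p`
intersection points with `α`. -/
def Connected : Prop :=
  ∀ k : ℕ, k < D.p → ∃ n : ℕ,
    ((D.step)^[n] start0).top = true ∧ ((D.step)^[n] start0).pos % D.pz = (k : ℤ)

/-- `β` crosses the intersection point with top-edge coordinate `≡ k (mod p)`
upwards, with respect to the reference orientation of `β`. -/
def UpAt (k : ℤ) : Prop :=
  ∃ n : ℕ, ((D.step)^[n] start0).top = true ∧
    ((D.step)^[n] start0).pos % D.pz = k % D.pz ∧ ((D.step)^[n] start0).up = true

/-- The algebraic intersection number `α · β` computed with the reference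
orientation of `β` (and `α` oriented from left to right). -/
def algInt : ℤ := ∑ k ∈ Finset.range D.p, (if D.UpAt (k : ℤ) then (1 : ℤ) else -1)

/-- One step forward along `β` for the orientation of `β` normalised so that
`α · β > 0`. -/
def fstep (σ : CState) : CState := if 0 < D.algInt then D.step σ else D.stepB σ

/-- With the normalised orientation, `β` crosses `α` upwards at the given state. -/
def TrueUp (σ : CState) : Prop := (0 < D.algInt ↔ σ.up = true)

/-- With the normalised orientation, `β` crosses the intersection point with
top-edge coordinate `≡ k (mod p)` upwards. -/
def TrueUpPt (k : ℤ) : Prop := (0 < D.algInt ↔ D.UpAt k)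

/-- The canonical state sitting at the intersection point `k` on the line `y = 0`
(of the chosen lift `α̃` of `α`). -/
def spt (k : ℕ) : CState := ⟨(k : ℤ), if D.UpAt (k : ℤ) then true else false, true, 0⟩

/-- The state is an intersection point of `β̃` with the line `y = 0`
(recorded with its canonical top-edge coordinate). -/
def IsCross0 (σ : CState) : Prop := σ.top = true ∧ σ.ht = 0

/-- The portion of `β̃` after `σ` returns to the line `y = 0`; that is, `σ` is the
starting point of a compact arc cut off by `α̃` rather than of a ray. -/
def Returns0 (σ : CState) : Prop := ∃ n : ℕ, 1 ≤ n ∧ IsCross0 ((D.fstep)^[n] σ)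

/-- Number of `fstep`-moves until the next intersection with the line `y = 0`. -/
def ret0Steps (σ : CState) : ℕ := sInf {n : ℕ | 1 ≤ n ∧ IsCross0 ((D.fstep)^[n] σ)}

/-- The next intersection point of `β̃` with the line `y = 0` after `σ`. -/
def nxt0 (σ : CState) : CState := (D.fstep)^[D.ret0Steps σ] σ

/-- The label (downstairs intersection point) of a state. -/
def lab (σ : CState) : ℤ := σ.pos % D.pz

/-- The compact arc of `β̃` starting at the intersection point `k` of the line
`y = 0` is oriented rightward (for the normalised orientation of `β`). -/
def ArcRight (k : ℕ) : Prop := (k : ℤ) < (D.nxt0 (D.spt k)).pos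

/-- Starting points of the compact arcs in the upper half-plane cut off by `α̃`
from the union of the lifts `β̃ₛ`. -/
def UpperStarts : Finset ℕ :=
  (Finset.range D.p).filter fun k => D.Returns0 (D.spt k) ∧ D.TrueUp (D.spt k)

/-- Starting points of the compact arcs in the lower half-plane. -/
def LowerStarts : Finset ℕ :=
  (Finset.range D.p).filter fun k => D.Returns0 (D.spt k) ∧ ¬ D.TrueUp (D.spt k)

/-- The number of compact arcs in the upper half-plane with orientation `b`
(`true` = rightward, `false` = leftward). -/
def uCnt (b : Bool) : ℕ := (D.UpperStarts.filter fun k => D.ArcRight k ↔ b = true).card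

/-- The number of compact arcs in the lower half-plane with orientation `b`. -/
def lCnt (b : Bool) : ℕ := (D.LowerStarts.filter fun k => D.ArcRight k ↔ b = true).card

/-- Definition 3.2: the standard diagram is *virtually almost coherent* if, for an
admissible choice of inconsistent direction in each half-plane (the inconsistent
direction must be carried by at most as many arcs as the other direction), the
union of the lifts `β̃ₛ` contains exactly two inconsistent arcs. -/
def VirtuallyAlmostCoherent : Prop :=
  ∃ dU dL : Bool,
    D.uCnt dU ≤ D.uCnt (!dU) ∧ D.lCnt dL ≤ D.lCnt (!dL) ∧ D.uCnt dU + D.lCnt dL = 2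

/-- `k` is the starting point of one of the two inconsistent arcs, for the choice
`(dU, dL)` of inconsistent directions in the upper and lower half-planes. -/
def InconsCoverArc (dU dL : Bool) (k : ℕ) : Prop :=
  (k ∈ D.UpperStarts ∧ (D.ArcRight k ↔ dU = true)) ∨
  (k ∈ D.LowerStarts ∧ (D.ArcRight k ↔ dL = true))

/-! ### Rainbow arcs of the diagram downstairs -/

/-- The rainbow arcs of the standard diagram: `(true, i)` with `r ≤ i < r + q` is the
rainbow arc attached to the top edge with feet `i` and `2r + 2q - 1 - i`; `(false, j)`
with `j < q` is the rainbow arc attached to the bottom edge with feet `j` and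
`2q - 1 - j`.  The two families are the rainbow arcs around the two basepoints. -/
def rainbowArcs : Finset (Bool × ℕ) :=
  ((Finset.Ico D.r (D.r + D.q)).image fun i => ((true : Bool), i)) ∪
    ((Finset.range D.q).image fun j => ((false : Bool), j))

/-- The two endpoints of a rainbow arc, as intersection points of `α ∩ β` recorded
by their top-edge coordinates in `ZMod p`. -/
def rEnds (a : Bool × ℕ) : Finset (ZMod D.p) :=
  if a.1 then
    {((a.2 : ℤ) : ZMod D.p), ((2 * D.rz + 2 * D.qz - 1 - (a.2 : ℤ) : ℤ) : ZMod D.p)}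
  else
    {(((a.2 : ℤ) - D.sz : ℤ) : ZMod D.p), ((2 * D.qz - 1 - (a.2 : ℤ) - D.sz : ℤ) : ZMod D.p)}

/-- A rainbow arc is oriented rightward (with the normalised orientation of `β`):
a top-edge rainbow arc is traversed starting from the endpoint where `β` crosses `α`
downwards, a bottom-edge one from the endpoint where `β` crosses `α` upwards. -/
def rOrientRight (a : Bool × ℕ) : Prop :=
  if a.1 then ¬ D.TrueUpPt (a.2 : ℤ) else D.TrueUpPt ((a.2 : ℤ) - D.sz)

/-- The number of rainbow arcs in the family `f` (`true` = attached to the top edge)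
with orientation `b` (`true` = rightward). -/
def famCnt (f : Bool) (b : Bool) : ℕ :=
  (D.rainbowArcs.filter fun a => a.1 = f ∧ (D.rOrientRight a ↔ b = true)).card

/-- `a` is an inconsistent rainbow arc for the choice `(dT, dB)` of inconsistent
directions for the two families. -/
def InconsArc (dT dB : Bool) (a : Bool × ℕ) : Prop :=
  a ∈ D.rainbowArcs ∧ (D.rOrientRight a ↔ (if a.1 then dT else dB) = true)

/-- Two rainbow arcs share a common endpoint. -/
def ShareEnd (a b : Bool × ℕ) : Prop := ((D.rEnds a) ∩ (D.rEnds b)).Nonempty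

/-- Two rainbow arcs are connected to each other by two other rainbow arcs. -/
def ConnectedByTwo (a1 a2 : Bool × ℕ) : Prop :=
  ∃ b1 b2 : Bool × ℕ, b1 ∈ D.rainbowArcs ∧ b2 ∈ D.rainbowArcs ∧
    b1 ≠ a1 ∧ b1 ≠ a2 ∧ b2 ≠ a1 ∧ b2 ≠ a2 ∧ b1 ≠ b2 ∧
    D.ShareEnd a1 b1 ∧ D.ShareEnd b1 b2 ∧ D.ShareEnd b2 a2

/-- Definition 1.2: the standard diagram is *strongly almost coherent* if, for an
admissible choice of inconsistent directions, there are exactly two inconsistent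
rainbow arcs, and either they share a common endpoint, or they are connected to each
other by two other rainbow arcs. -/
def StronglyAlmostCoherent : Prop :=
  ∃ dT dB : Bool,
    D.famCnt true dT ≤ D.famCnt true (!dT) ∧ D.famCnt false dB ≤ D.famCnt false (!dB) ∧
    ∃ a1 a2 : Bool × ℕ, a1 ≠ a2 ∧ (∀ a, D.InconsArc dT dB a ↔ (a = a1 ∨ a = a2)) ∧
      (D.ShareEnd a1 a2 ∨ D.ConnectedByTwo a1 a2)

/-! ### Spin^c classes of intersection points -/

/-- The point `l` is reached from the point `k` by travelling forward along the lift
`β̃` through (the lift at height `0` of) `k`, meeting it on the line `y = 0`. -/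
def Reach (k l : ℕ) : Prop :=
  ∃ n : ℕ, IsCross0 ((D.fstep)^[n] (D.spt k)) ∧
    ((D.fstep)^[n] (D.spt k)).pos % D.pz = (l : ℤ)

/-- Two intersection points are in the same class (i.e. they induce the same
spin^c structure): some lift of `β` meeting the line `y = 0` passes through lifts
of both of them on that line. -/
def SameClass (k l : ℕ) : Prop := D.Reach k l ∨ D.Reach l k

/-! ### The sequence of intersection points along a lift -/

/-- The `m`-th intersection point of `β̃ₛ` with the line `y = 0` after the point `c`. -/
def seqSt (c m : ℕ) : CState := (D.nxt0)^[m] (D.spt c)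

/-- Its label downstairs. -/
def labAt (c m : ℕ) : ℤ := D.lab (D.seqSt c m)

/-- Its position coordinate on the line `y = 0`. -/
def posAt (c m : ℕ) : ℤ := (D.seqSt c m).pos

/-- The differential component carried by the compact arc starting at `k` points
from the starting point of the arc towards its end point.  (For an arc in the upper
half-plane the source of the arrow is the right endpoint, for an arc in the lower
half-plane it is the left endpoint.) -/
def srcIsStart (k : ℕ) : Prop :=
  ¬ (D.TrueUp (D.spt k) ↔ (k : ℤ) < (D.nxt0 (D.spt k)).pos)

/-- The label of the source of the differential component carried by the arc
starting at `k`. -/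
def srcLab (k : ℕ) : ℤ :=
  if D.srcIsStart k then (k : ℤ) % D.pz else (D.nxt0 (D.spt k)).pos % D.pz

/-- The label of the target of the differential component carried by the arc
starting at `k`. -/
def tgtLab (k : ℕ) : ℤ :=
  if D.srcIsStart k then (D.nxt0 (D.spt k)).pos % D.pz else (k : ℤ) % D.pz

/-- The number of bigons (compact arcs) inducing a differential component from `x`
to `y`. -/
def arrowCnt (x y : ℕ) : ℕ :=
  ((Finset.range D.p).filter fun k =>
    D.Returns0 (D.spt k) ∧ D.srcLab k = (x : ℤ) ∧ D.tgtLab k = (y : ℤ)).card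


/-! ### Counting basepoints inside the bigon cut off by a compact arc -/

/-- Doubled plane `x`-coordinate of a state in the (sheared) universal cover. -/
def x2 (σ : CState) : ℤ := 2 * σ.pos - 2 * D.sz * (if σ.top then σ.ht - 1 else σ.ht)

/-- The number of crossings of the upward vertical ray emanating from the basepoint
slot in row `ρ` with doubled `x`-coordinate `X0` (a `w`-slot if `isZ = false`, sitting
just above the line `y = ρ`; a `z`-slot if `isZ = true`, sitting just below the line
`y = ρ + 1`) with the piece of `β̃` between the state `σ` and the next state. -/
def rayCross (σ : CState) (X0 ρ : ℤ) (isZ : Bool) : ℕ :=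
  let σ' := D.fstep σ
  let lo := min (D.x2 σ) (D.x2 σ')
  let hi := max (D.x2 σ) (D.x2 σ')
  if σ.ht ≠ σ'.ht then
    -- a strand crossing the row between the lines `y = min ht` and `y = min ht + 1`
    (if (ρ < min σ.ht σ'.ht ∨ (ρ = min σ.ht σ'.ht ∧ isZ = false)) ∧ lo < X0 ∧ X0 < hi
      then 1 else 0)
  else if σ.top = σ'.top then
    if σ.top then
      -- a rainbow arch hanging below the line `y = σ.ht`
      (if (if isZ then ρ ≤ σ.ht - 2 else ρ ≤ σ.ht - 1) ∧ lo < X0 ∧ X0 < hi then 1 else 0)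
    else
      -- a rainbow arch sitting above the line `y = σ.ht`
      (if (if isZ then ρ ≤ σ.ht - 1 else ρ ≤ σ.ht) ∧ lo < X0 ∧ X0 < hi then 1 else 0)
  else 0

/-- Doubled plane `x`-coordinate of the basepoint slot of row `ρ`, horizontal
translate `m`: the `w`-basepoint is between bottom-edge coordinates `q - 1` and `q`,
the `z`-basepoint between top-edge coordinates `r + q - 1` and `r + q`. -/
def slotX2 (ρ m : ℤ) (isZ : Bool) : ℤ :=
  (if isZ then 2 * (D.rz + D.qz) - 1 else 2 * D.qz - 1) - 2 * ρ * D.sz + 2 * m * D.pz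

/-- The states traversed by the compact arc starting at the intersection point `k`. -/
def arcState (k i : ℕ) : CState := (D.fstep)^[i] (D.spt k)

/-- Number of crossings of the upward vertical ray from a slot with the chord of the
bigon (the segment of the line `y = 0` joining the endpoints of the arc). -/
def chordCross (k : ℕ) (X0 ρ : ℤ) : ℕ :=
  if ρ ≤ -1 ∧ min (D.x2 (D.spt k)) (D.x2 (D.nxt0 (D.spt k))) < X0 ∧
      X0 < max (D.x2 (D.spt k)) (D.x2 (D.nxt0 (D.spt k))) then 1 else 0

/-- A basepoint slot lies inside the (embedded) bigon cobounded by the compact arc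
starting at `k` and the line `y = 0`: the upward vertical ray from the slot meets the
boundary of the bigon an odd number of times. -/
def SlotInBigon (k : ℕ) (ρ m : ℤ) (isZ : Bool) : Prop :=
  ¬ (2 ∣ ((D.chordCross k (D.slotX2 ρ m isZ) ρ : ℤ) +
      ∑ i ∈ Finset.range (D.ret0Steps (D.spt k)),
        (D.rayCross (D.arcState k i) (D.slotX2 ρ m isZ) ρ isZ : ℤ)))

/-- A bound for the rows met by the arc starting at `k`. -/
def hBound (k : ℕ) : ℕ :=
  ((Finset.range (D.ret0Steps (D.spt k) + 1)).sup fun i => (D.arcState k i).ht.natAbs) + 2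

/-- A bound for the horizontal translates of slots met by the arc starting at `k`. -/
def mBound (k : ℕ) : ℕ :=
  ((Finset.range (D.ret0Steps (D.spt k) + 1)).sup fun i => (D.arcState k i).pos.natAbs)
    + (D.hBound k + 2) * (D.s + 1) + D.p + D.q + D.r + 4

/-- The number of lifts of the `w`-basepoint (`isZ = false`), respectively of the
`z`-basepoint (`isZ = true`), inside the bigon cobounded by the compact arc starting
at `k` and the line `y = 0`. -/
def arcBase (k : ℕ) (isZ : Bool) : ℕ :=
  (((Finset.Icc (-(D.hBound k : ℤ)) (D.hBound k)) ×ˢ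
      (Finset.Icc (-(D.mBound k : ℤ)) (D.mBound k))).filter
    fun ρm => D.SlotInBigon k ρm.1 ρm.2 isZ).card

/-- The arc starting at `k` stays within the two rows adjacent to the line `y = 0`
(equivalently, it has height `< 1`). -/
def ArcWithinRow (k : ℕ) : Prop :=
  ∀ n : ℕ, n ≤ D.ret0Steps (D.spt k) → (D.arcState k n).ht = 0

/-- The arc starting at `k` is a lift of a single rainbow arc of the diagram. -/
def ArcIsRainbowLift (k : ℕ) : Prop := D.ret0Steps (D.spt k) = 3

/-! ### Gradings and filtrations of the knot Floer complex -/

/-- The relative Maslov grading changes by `±1` along each arc, dropping (by `1`)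
from the source of its differential component to the target. -/
def grStep (k : ℕ) : ℤ := if D.srcIsStart k then -1 else 1

/-- The relative `i`-filtration drops, from the source of the differential component
carried by an arc to the target, by the number of `w`-basepoints in its bigon. -/
def faStep (k : ℕ) : ℤ := (if D.srcIsStart k then -1 else 1) * (D.arcBase k false : ℤ)

/-- The relative `j`-filtration drops by the number of `z`-basepoints in the bigon. -/
def fbStep (k : ℕ) : ℤ := (if D.srcIsStart k then -1 else 1) * (D.arcBase k true : ℤ)

/-- The sum of the per-arc increments of a relative grading along the first `m` arcs
of the lift `β̃` starting at the point `c`. -/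
def pathSum (f : ℕ → ℤ) (c m : ℕ) : ℤ := ∑ i ∈ Finset.range m, f (D.labAt c i).toNat

/-- `a` occurs in the forward sequence of intersection points of `β̃` with the line
`y = 0` starting at `c`. -/
def ReachIn (c a : ℕ) : Prop := ∃ m : ℕ, D.labAt c m = (a : ℤ)

/-- The value at `a` of the relative grading with per-arc increments `f`, normalised
to vanish at the base point `c` of the class. -/
def relOf (f : ℕ → ℤ) (c a : ℕ) : ℤ :=
  if h : D.ReachIn c a then D.pathSum f c (Nat.find h)
  else if h' : D.ReachIn a c then - D.pathSum f a (Nat.find h') else 0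

/-- The Maslov grading of the generator `a` of the class of `c` (normalised at `c`). -/
def grOf (c a : ℕ) : ℤ := D.relOf D.grStep c a

/-- The `i`-filtration of the generator `a` of the class of `c`. -/
def faOf (c a : ℕ) : ℤ := D.relOf D.faStep c a

/-- The `j`-filtration of the generator `a` of the class of `c`. -/
def fbOf (c a : ℕ) : ℤ := D.relOf D.fbStep c a

/-- The number of generators of the class of `c` in Maslov grading `g`. -/
def grCountClass (c : ℕ) (g : ℤ) : ℕ :=
  ((Finset.range D.p).filter fun a => D.SameClass a c ∧ D.grOf c a = g).card

/-! ### Turning points -/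

/-- The differential component of the arc from the `i`-th to the `(i+1)`-st point of
the sequence along `β̃ₛ` starting at `c` points forward. -/
def srcIsStartAt (c i : ℕ) : Prop := D.srcIsStart (D.labAt c i).toNat

/-- The cumulative relative Maslov grading of the `m`-th point of the sequence along
`β̃ₛ` starting at `c`. -/
def grPartial (c m : ℕ) : ℤ :=
  ∑ i ∈ Finset.range m, (if D.srcIsStartAt c i then (-1 : ℤ) else 1)

/-- The `m`-th point of the sequence along `β̃ₛ` starting at `c` is a *turning point*:
its position on the line `y = 0` is either greater or smaller than the positions of
both its predecessor and its successor. -/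
def TurningAt (c m : ℕ) : Prop :=
  1 ≤ m ∧ ((D.posAt c (m - 1) < D.posAt c m ∧ D.posAt c (m + 1) < D.posAt c m) ∨
    (D.posAt c m < D.posAt c (m - 1) ∧ D.posAt c m < D.posAt c (m + 1)))

/-- A *positive* turning point: its predecessor appears in its differential. -/
def PosTurningAt (c m : ℕ) : Prop := D.TurningAt c m ∧ ¬ D.srcIsStartAt c (m - 1)

/-- A *negative* turning point: it appears in the differential of its predecessor. -/
def NegTurningAt (c m : ℕ) : Prop := D.TurningAt c m ∧ D.srcIsStartAt c (m - 1)

end StdDiagram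

/-! ### Bifiltered complexes over 𝔽₂ -/

/-- A based, bifiltered, Maslov-graded complex over `𝔽₂ = ZMod 2`:  `d x y` is the
coefficient of the basis element `y` in the differential of the basis element `x`,
`gr` is the Maslov grading and `(fa, fb)` the `(i, j)`-bifiltration levels of the
basis elements. -/
structure BFC where
  ι : Type
  fin : Fintype ι
  dec : DecidableEq ι
  d : ι → ι → ZMod 2
  gr : ι → ℤ
  fa : ι → ℤ
  fb : ι → ℤ

attribute [instance] BFC.fin BFC.dec

namespace BFC

/-- The dual of a bifiltered complex. -/
def dual (C : BFC) : BFC :=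
  ⟨C.ι, C.fin, C.dec, fun u v => C.d v u, fun u => - C.gr u, fun u => - C.fa u,
    fun u => - C.fb u⟩

/-- The subcomplex (of a direct summand) spanned by the basis elements selected
by `S`. -/
def sub (C : BFC) (S : C.ι → Bool) : BFC where
  ι := {u : C.ι // S u = true}
  fin := Subtype.fintype _
  dec := Classical.decEq _
  d u v := C.d u.1 v.1
  gr u := C.gr u.1
  fa u := C.fa u.1
  fb u := C.fb u.1

/-- The number of basis elements in Maslov grading `g`. -/
def grCount (C : BFC) (g : ℤ) : ℕ := (Finset.univ.filter fun u : C.ι => C.gr u = g).card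

end BFC

/-- Definition 2.1: a positive staircase with `2N + 1` generators
`y₁, x₁, y₂, x₂, …, y_{N+1}` (even positions along the zigzag are the `y`'s, odd
positions the `x`'s), with `∂ xₗ = yₗ + y_{ℓ+1}`, `∂ yₗ = 0`, where consecutive
generators differ in only one of the two filtration coordinates, alternately. -/
def IsPosStaircaseOf (N : ℕ) (C : BFC) : Prop :=
  ∃ (e : Fin (2 * N + 1) ≃ C.ι) (f : Bool),
    (∀ k l : Fin (2 * N + 1), C.d (e k) (e l) =
      if k.1 % 2 = 1 ∧ (k.1 = l.1 + 1 ∨ l.1 = k.1 + 1) then 1 else 0) ∧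
    (∀ k l : Fin (2 * N + 1), l.1 = k.1 + 1 →
      (C.gr (e l) = C.gr (e k) + (if k.1 % 2 = 0 then 1 else -1)) ∧
      (if decide (k.1 % 2 = 0) = f then
        C.fb (e k) = C.fb (e l) ∧
          (if k.1 % 2 = 0 then C.fa (e k) < C.fa (e l) else C.fa (e l) < C.fa (e k))
      else
        C.fa (e k) = C.fa (e l) ∧
          (if k.1 % 2 = 0 then C.fb (e k) < C.fb (e l) else C.fb (e l) < C.fb (e k))))

/-- A positive staircase (of any length). -/
def IsPosStaircase (C : BFC) : Prop := ∃ N : ℕ, IsPosStaircaseOf N C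

/-- A negative staircase is the dual of a positive staircase. -/
def IsNegStaircase (C : BFC) : Prop := IsPosStaircase C.dual

/-- A staircase: a positive or a negative staircase. -/
def IsStaircase (C : BFC) : Prop := IsPosStaircase C ∨ IsNegStaircase C

/-- A staircase of given sign (`true` = positive). -/
def IsSignedStaircase (b : Bool) (C : BFC) : Prop :=
  if b then IsPosStaircase C else IsNegStaircase C

/-- A box of length 1: generators `a, b, c, d` at bifiltration levels
`(0,0), (0,1), (1,0), (1,1)` (up to an overall shift), with `∂d = b + c`,
`∂b = ∂c = a`, `∂a = 0`. -/
def IsBox (C : BFC) : Prop :=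
  ∃ (e : Fin 4 ≃ C.ι) (a0 b0 g0 : ℤ),
    C.fa (e 0) = a0 ∧ C.fb (e 0) = b0 ∧ C.gr (e 0) = g0 ∧
    C.fa (e 1) = a0 ∧ C.fb (e 1) = b0 + 1 ∧ C.gr (e 1) = g0 + 1 ∧
    C.fa (e 2) = a0 + 1 ∧ C.fb (e 2) = b0 ∧ C.gr (e 2) = g0 + 1 ∧
    C.fa (e 3) = a0 + 1 ∧ C.fb (e 3) = b0 + 1 ∧ C.gr (e 3) = g0 + 2 ∧
    (∀ k l : Fin 4, C.d (e k) (e l) =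
      if (k = 3 ∧ (l = 1 ∨ l = 2)) ∨ ((k = 1 ∨ k = 2) ∧ l = 0) then 1 else 0)

/-- `C` is the direct sum of a complex satisfying `P1` and one satisfying `P2`. -/
def IsDirectSumOf (C : BFC) (P1 P2 : BFC → Prop) : Prop :=
  ∃ S : C.ι → Bool, (∀ u v : C.ι, S u ≠ S v → C.d u v = 0) ∧
    P1 (C.sub S) ∧ P2 (C.sub fun u => ! S u)

/-- Definition 2.3 (a): a positive almost staircase of type (a), with generators
`x₁, …, x_{2k}`, `y₁, …, y_{2k+1}`, `y'_{k+1}` and `z`. -/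
def IsPosAlmostStairA (C : BFC) : Prop :=
  ∃ k : ℕ, 1 ≤ k ∧ ∃ (X Y : ℕ → C.ι) (y' z : C.ι) (a0 b0 : ℤ),
    Fintype.card C.ι = 4 * k + 3 ∧
    (∀ u : C.ι, u = y' ∨ u = z ∨ (∃ ℓ, 1 ≤ ℓ ∧ ℓ ≤ 2 * k ∧ u = X ℓ) ∨
      (∃ ℓ, 1 ≤ ℓ ∧ ℓ ≤ 2 * k + 1 ∧ u = Y ℓ)) ∧
    (∀ u v : C.ι, C.d u v ≠ 0 → C.gr u = C.gr v + 1) ∧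
    C.fa (Y (k + 1)) = a0 ∧ C.fb (Y (k + 1)) = b0 + 1 ∧
    C.fa y' = a0 + 1 ∧ C.fb y' = b0 ∧ C.fa z = a0 ∧ C.fb z = b0 ∧
    (∀ ℓ, 1 ≤ ℓ → ℓ ≤ 2 * k → C.fb (X ℓ) = C.fb (Y ℓ) ∧ C.fa (Y ℓ) < C.fa (X ℓ)) ∧
    (∀ ℓ, 1 ≤ ℓ → ℓ ≤ 2 * k → ℓ ≠ k →
      C.fa (X ℓ) = C.fa (Y (ℓ + 1)) ∧ C.fb (Y (ℓ + 1)) < C.fb (X ℓ)) ∧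
    (C.fa (X k) = C.fa y' ∧ C.fb y' < C.fb (X k)) ∧
    (∀ ℓ, 1 ≤ ℓ → ℓ ≤ 2 * k → ℓ ≠ k → ℓ ≠ k + 1 →
      ∀ v, C.d (X ℓ) v = if v = Y ℓ ∨ v = Y (ℓ + 1) then 1 else 0) ∧
    (∀ v, C.d (X k) v = if v = Y k ∨ v = Y (k + 1) ∨ v = y' then 1 else 0) ∧
    (∀ v, C.d (X (k + 1)) v = if v = Y (k + 1) ∨ v = Y (k + 2) ∨ v = y' then 1 else 0) ∧
    (∀ v, C.d (Y (k + 1)) v = if v = z then 1 else 0) ∧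
    (∀ v, C.d y' v = if v = z then 1 else 0) ∧
    (∀ ℓ, 1 ≤ ℓ → ℓ ≤ 2 * k + 1 → ℓ ≠ k + 1 → ∀ v, C.d (Y ℓ) v = 0) ∧
    (∀ v, C.d z v = 0)

/-- Definition 2.3 (b): a positive almost staircase of type (b), with generators
`x₁, …, x_{2k+1}`, `x'_{k+1}`, `y₁, …, y_{2k+2}` and `z`. -/
def IsPosAlmostStairB (C : BFC) : Prop :=
  ∃ k : ℕ, 1 ≤ k ∧ ∃ (X Y : ℕ → C.ι) (x' z : C.ι) (a0 b0 : ℤ),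
    Fintype.card C.ι = 4 * k + 5 ∧
    (∀ u : C.ι, u = x' ∨ u = z ∨ (∃ ℓ, 1 ≤ ℓ ∧ ℓ ≤ 2 * k + 1 ∧ u = X ℓ) ∨
      (∃ ℓ, 1 ≤ ℓ ∧ ℓ ≤ 2 * k + 2 ∧ u = Y ℓ)) ∧
    (∀ u v : C.ι, C.d u v ≠ 0 → C.gr u = C.gr v + 1) ∧
    C.fa (X (k + 1)) = a0 ∧ C.fb (X (k + 1)) = b0 - 1 ∧
    C.fa x' = a0 - 1 ∧ C.fb x' = b0 ∧ C.fa z = a0 ∧ C.fb z = b0 ∧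
    (∀ ℓ, 1 ≤ ℓ → ℓ ≤ 2 * k + 1 → C.fb (X ℓ) = C.fb (Y ℓ) ∧ C.fa (Y ℓ) < C.fa (X ℓ)) ∧
    (∀ ℓ, 1 ≤ ℓ → ℓ ≤ 2 * k + 1 → ℓ ≠ k + 1 →
      C.fa (X ℓ) = C.fa (Y (ℓ + 1)) ∧ C.fb (Y (ℓ + 1)) < C.fb (X ℓ)) ∧
    (C.fa x' = C.fa (Y (k + 2)) ∧ C.fb (Y (k + 2)) < C.fb x') ∧
    (∀ ℓ, 1 ≤ ℓ → ℓ ≤ 2 * k + 1 → ℓ ≠ k + 1 →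
      ∀ v, C.d (X ℓ) v = if v = Y ℓ ∨ v = Y (ℓ + 1) then 1 else 0) ∧
    (∀ v, C.d z v = if v = X (k + 1) ∨ v = x' then 1 else 0) ∧
    (∀ v, C.d (X (k + 1)) v = if v = Y (k + 1) ∨ v = Y (k + 2) then 1 else 0) ∧
    (∀ v, C.d x' v = if v = Y (k + 1) ∨ v = Y (k + 2) then 1 else 0) ∧
    (∀ ℓ, 1 ≤ ℓ → ℓ ≤ 2 * k + 2 → ∀ v, C.d (Y ℓ) v = 0)

/-- A positive almost staircase. -/
def IsPosAlmostStaircase (C : BFC) : Prop := IsPosAlmostStairA C ∨ IsPosAlmostStairB C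

/-- A negative almost staircase is the dual of a positive almost staircase. -/
def IsNegAlmostStaircase (C : BFC) : Prop := IsPosAlmostStaircase C.dual

/-- `C'` is obtained from `C` by a filtered change of basis: each basis element is
replaced by itself plus a sum of basis elements of the same Maslov grading and of
bifiltration level not higher in either coordinate. -/
def FilteredBasisChange (C C' : BFC) : Prop :=
  ∃ e : C'.ι ≃ C.ι,
    (∀ u, C'.gr u = C.gr (e u)) ∧ (∀ u, C'.fa u = C.fa (e u)) ∧
    (∀ u, C'.fb u = C.fb (e u)) ∧
    ∃ P Q : Matrix C.ι C.ι (ZMod 2),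
      P * Q = 1 ∧ Q * P = 1 ∧ (∀ u, P u u = 1) ∧
      (∀ u v, u ≠ v → P u v ≠ 0 → C.gr u = C.gr v ∧ C.fa v ≤ C.fa u ∧ C.fb v ≤ C.fb u) ∧
      (∀ u v, C'.d u v = (P * Matrix.of C.d * Q) (e u) (e v))

/-- `C` satisfies `P` after some filtered change of basis. -/
def AfterFCB (C : BFC) (P : BFC → Prop) : Prop := ∃ C', FilteredBasisChange C C' ∧ P C'

/-- The knot Floer chain complex `CFK(H, s)` of the standard diagram, in the spin^c
class of the intersection point `c`: it is generated by the intersection points of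
the class of `c`; the coefficient `⟨∂x, y⟩` counts (mod 2) the embedded bigons in
the universal cover cobounded by `α̃` and `β̃ₛ` from a lift of `x` to a lift of `y`;
the relative Maslov grading drops by `1` along each differential, and the relative
`(i, j)`-bifiltration drops according to the number of lifts of the basepoints `w`
and `z` covered by each bigon. -/
def CFK (D : StdDiagram) (c : ℕ) : BFC where
  ι := {a : Fin D.p // D.SameClass a c}
  fin := Subtype.fintype _
  dec := Classical.decEq _
  d x y := (D.arrowCnt x.1 y.1 : ZMod 2)
  gr x := D.grOf c x.1
  fa x := D.faOf c x.1
  fb x := D.fbOf c x.1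

attribute [ext] CState

namespace CState

/-- The same point, traversed in the opposite direction. -/
def rev (σ : CState) : CState := ⟨σ.pos, !σ.up, σ.top, σ.ht⟩

@[simp] theorem rev_pos (σ : CState) : σ.rev.pos = σ.pos := rfl
@[simp] theorem rev_up (σ : CState) : σ.rev.up = !σ.up := rfl
@[simp] theorem rev_top (σ : CState) : σ.rev.top = σ.top := rfl
@[simp] theorem rev_ht (σ : CState) : σ.rev.ht = σ.ht := rfl
@[simp] theorem rev_rev (σ : CState) : σ.rev.rev = σ := by ext <;> simp

/-- The index of the row of the universal cover containing the part of `β̃` adjacent to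
the state on the side recorded by `top`. -/
def row (σ : CState) : ℤ := if σ.top then σ.ht - 1 else σ.ht

end CState

namespace StdDiagram

variable (D : StdDiagram)

/-! ### The step map -/

theorem pz_pos : 0 < D.pz := by have := D.hp; unfold pz; exact_mod_cast this

theorem two_qz_add_rz_le : 2 * D.qz + D.rz ≤ D.pz := by
  have := D.h2qr; unfold pz qz rz; exact_mod_cast this

theorem qz_nonneg : 0 ≤ D.qz := Int.natCast_nonneg _

theorem rz_nonneg : 0 ≤ D.rz := Int.natCast_nonneg _

variable {D} in
theorem emod_pz {m : ℤ} (h₀ : 0 ≤ m) (h₁ : m < D.pz) (t : ℤ) :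
    (m + D.pz * t) % D.pz = m := by
  rw [Int.add_mul_emod_self_left, Int.emod_eq_of_lt h₀ h₁]

section StepRules

variable {D}

theorem step_top_up (x h : ℤ) :
    D.step ⟨x, true, true, h⟩ = ⟨x + D.sz, true, false, h⟩ := by simp [step]

theorem step_bot_down (x h : ℤ) :
    D.step ⟨x, false, false, h⟩ = ⟨x - D.sz, false, true, h⟩ := by simp [step]

theorem step_top_down_left {m : ℤ} (h₀ : 0 ≤ m) (h₁ : m < D.rz) (t h : ℤ) :
    D.step ⟨m + D.pz * t, false, true, h⟩ =
      ⟨m + 2 * D.qz + D.pz * t, false, false, h - 1⟩ := by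
  have := D.two_qz_add_rz_le
  have := D.qz_nonneg
  have e := emod_pz (D := D) h₀ (by omega) t
  simp only [step, e, Bool.false_eq_true, reduceIte]
  rw [if_pos (by omega)]
  congr 1; ring

theorem step_top_down_arc {m : ℤ} (h₀ : D.rz ≤ m) (h₁ : m < D.rz + 2 * D.qz) (t h : ℤ) :
    D.step ⟨m + D.pz * t, false, true, h⟩ =
      ⟨2 * D.rz + 2 * D.qz - 1 - m + D.pz * t, true, true, h⟩ := by
  have := D.two_qz_add_rz_le
  have := D.rz_nonneg
  have e := emod_pz (D := D) (m := m) (by omega) (by omega) t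
  simp only [step, e, Bool.false_eq_true, reduceIte]
  rw [if_neg (by omega), if_pos (by omega)]
  congr 1; ring

theorem step_top_down_right {m : ℤ} (h₀ : D.rz + 2 * D.qz ≤ m) (h₁ : m < D.pz) (t h : ℤ) :
    D.step ⟨m + D.pz * t, false, true, h⟩ = ⟨m + D.pz * t, false, false, h - 1⟩ := by
  have := D.qz_nonneg
  have := D.rz_nonneg
  have e := emod_pz (D := D) (m := m) (by omega) (by omega) t
  simp only [step, e, Bool.false_eq_true, reduceIte]
  rw [if_neg (by omega), if_neg (by omega)]

theorem step_bot_up_arc {m : ℤ} (h₀ : 0 ≤ m) (h₁ : m < 2 * D.qz) (t h : ℤ) :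
    D.step ⟨m + D.pz * t, true, false, h⟩ =
      ⟨2 * D.qz - 1 - m + D.pz * t, false, false, h⟩ := by
  have := D.two_qz_add_rz_le
  have := D.rz_nonneg
  have e := emod_pz (D := D) (m := m) (by omega) (by omega) t
  simp only [step, e, Bool.false_eq_true, Bool.true_eq_false, reduceIte]
  rw [if_pos (by omega)]
  congr 1; ring

theorem step_bot_up_left {m : ℤ} (h₀ : 2 * D.qz ≤ m) (h₁ : m < D.rz + 2 * D.qz) (t h : ℤ) :
    D.step ⟨m + D.pz * t, true, false, h⟩ =
      ⟨m - 2 * D.qz + D.pz * t, true, true, h + 1⟩ := by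
  have := D.two_qz_add_rz_le
  have := D.qz_nonneg
  have e := emod_pz (D := D) (m := m) (by omega) (by omega) t
  simp only [step, e, Bool.false_eq_true, Bool.true_eq_false, reduceIte]
  rw [if_neg (by omega), if_pos (by omega)]
  congr 1; ring

theorem step_bot_up_right {m : ℤ} (h₀ : D.rz + 2 * D.qz ≤ m) (h₁ : m < D.pz) (t h : ℤ) :
    D.step ⟨m + D.pz * t, true, false, h⟩ = ⟨m + D.pz * t, true, true, h + 1⟩ := by
  have := D.qz_nonneg
  have := D.rz_nonneg
  have e := emod_pz (D := D) (m := m) (by omega) (by omega) t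
  simp only [step, e, Bool.false_eq_true, Bool.true_eq_false, reduceIte]
  rw [if_neg (by omega), if_neg (by omega)]

/-- Case analysis along the pieces of `β`: crossings of `α`, rainbow arcs and strands. -/
theorem step_cases {P : CState → CState → Prop}
    (top_up : ∀ x h, P ⟨x, true, true, h⟩ ⟨x + D.sz, true, false, h⟩)
    (bot_down : ∀ x h, P ⟨x, false, false, h⟩ ⟨x - D.sz, false, true, h⟩)
    (top_down_left : ∀ m t h, 0 ≤ m → m < D.rz →
      P ⟨m + D.pz * t, false, true, h⟩ ⟨m + 2 * D.qz + D.pz * t, false, false, h - 1⟩)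
    (top_down_arc : ∀ m t h, D.rz ≤ m → m < D.rz + 2 * D.qz →
      P ⟨m + D.pz * t, false, true, h⟩
        ⟨2 * D.rz + 2 * D.qz - 1 - m + D.pz * t, true, true, h⟩)
    (top_down_right : ∀ m t h, D.rz + 2 * D.qz ≤ m → m < D.pz →
      P ⟨m + D.pz * t, false, true, h⟩ ⟨m + D.pz * t, false, false, h - 1⟩)
    (bot_up_arc : ∀ m t h, 0 ≤ m → m < 2 * D.qz →
      P ⟨m + D.pz * t, true, false, h⟩ ⟨2 * D.qz - 1 - m + D.pz * t, false, false, h⟩)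
    (bot_up_left : ∀ m t h, 2 * D.qz ≤ m → m < D.rz + 2 * D.qz →
      P ⟨m + D.pz * t, true, false, h⟩ ⟨m - 2 * D.qz + D.pz * t, true, true, h + 1⟩)
    (bot_up_right : ∀ m t h, D.rz + 2 * D.qz ≤ m → m < D.pz →
      P ⟨m + D.pz * t, true, false, h⟩ ⟨m + D.pz * t, true, true, h + 1⟩)
    (σ : CState) : P σ (D.step σ) := by
  obtain ⟨x, u, b, h⟩ := σ
  obtain ⟨m, t, rfl, h₀, h₁⟩ : ∃ m t, x = m + D.pz * t ∧ 0 ≤ m ∧ m < D.pz :=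
    ⟨x % D.pz, x / D.pz, (Int.emod_add_mul_ediv _ _).symm,
      Int.emod_nonneg _ D.pz_pos.ne', Int.emod_lt_of_pos _ D.pz_pos⟩
  have := D.qz_nonneg
  cases u <;> cases b
  · rw [step_bot_down]; exact bot_down _ _
  · rcases lt_or_ge m D.rz with h₂ | h₂
    · rw [step_top_down_left h₀ h₂]; exact top_down_left _ _ _ h₀ h₂
    rcases lt_or_ge m (D.rz + 2 * D.qz) with h₃ | h₃
    · rw [step_top_down_arc h₂ h₃]; exact top_down_arc _ _ _ h₂ h₃
    · rw [step_top_down_right h₃ h₁]; exact top_down_right _ _ _ h₃ h₁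
  · rcases lt_or_ge m (2 * D.qz) with h₂ | h₂
    · rw [step_bot_up_arc h₀ h₂]; exact bot_up_arc _ _ _ h₀ h₂
    rcases lt_or_ge m (D.rz + 2 * D.qz) with h₃ | h₃
    · rw [step_bot_up_left h₂ h₃]; exact bot_up_left _ _ _ h₂ h₃
    · rw [step_bot_up_right h₃ h₁]; exact bot_up_right _ _ _ h₃ h₁
  · rw [step_top_up]; exact top_up _ _

end StepRules

/-! ### Symmetries of the step map -/

/-- The deck transformation translating by `m` fundamental domains to the right and by `h`
lifts of `α` upwards. -/
def shift (m h : ℤ) (σ : CState) : CState := ⟨σ.pos + D.pz * m, σ.up, σ.top, σ.ht + h⟩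

section Shift

variable {D} (m h : ℤ) (σ : CState)

@[simp] theorem shift_pos : (D.shift m h σ).pos = σ.pos + D.pz * m := rfl
@[simp] theorem shift_up : (D.shift m h σ).up = σ.up := rfl
@[simp] theorem shift_top : (D.shift m h σ).top = σ.top := rfl
@[simp] theorem shift_ht : (D.shift m h σ).ht = σ.ht + h := rfl

@[simp] theorem row_shift : (D.shift m h σ).row = σ.row + h := by
  cases h : σ.top
  · simp [CState.row, h]
  · simp only [CState.row, shift_top, shift_ht, h, reduceIte]; ring

theorem shift_zero : D.shift 0 0 σ = σ := by ext <;> simp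

theorem shift_shift (m' h' : ℤ) :
    D.shift m h (D.shift m' h' σ) = D.shift (m + m') (h + h') σ := by
  ext <;> simp; all_goals ring

theorem rev_shift : (D.shift m h σ).rev = D.shift m h σ.rev := rfl

theorem step_shift : D.step (D.shift m h σ) = D.shift m h (D.step σ) := by
  simp only [step, shift, Int.add_mul_emod_self_left]
  split_ifs <;> ext <;> simp <;> ring

theorem iterate_step_shift (n : ℕ) :
    D.step^[n] (D.shift m h σ) = D.shift m h (D.step^[n] σ) :=
  ((Function.Commute.iterate_left (f := D.step) (g := D.shift m h)
    (fun τ => step_shift m h τ) n) σ)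

end Shift

theorem stepB_eq (σ : CState) : D.stepB σ = (D.step σ.rev).rev := by
  obtain ⟨x, u, b, h⟩ := σ
  have := D.qz_nonneg
  have := D.rz_nonneg
  cases u <;> cases b <;> simp only [stepB, step, CState.rev, Bool.not_true, Bool.not_false,
    Bool.false_eq_true, Bool.true_eq_false, reduceIte] <;> split_ifs <;> first | rfl | omega

variable {D}

theorem step_rev_step (σ : CState) : D.step (D.step σ).rev = σ.rev := by
  have := D.qz_nonneg
  have := D.rz_nonneg
  have := D.two_qz_add_rz_le
  refine step_cases (P := fun σ τ => D.step τ.rev = σ.rev) ?_ ?_ ?_ ?_ ?_ ?_ ?_ ?_ σ <;>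
    simp only [CState.rev, Bool.not_true, Bool.not_false]
  · intro x h; rw [step_bot_down]; ext <;> simp
  · intro x h; rw [step_top_up]; ext <;> simp
  · intro m t h h₀ h₁; rw [step_bot_up_left (by omega) (by omega)]; ext <;> simp
  · intro m t h h₀ h₁; rw [step_top_down_arc (by omega) (by omega)]; ext <;> simp
  · intro m t h h₀ h₁; rw [step_bot_up_right (by omega) (by omega)]; ext <;> simp
  · intro m t h h₀ h₁; rw [step_bot_up_arc (by omega) (by omega)]; ext <;> simp
  · intro m t h h₀ h₁; rw [step_top_down_left (by omega) (by omega)]; ext <;> simp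
  · intro m t h h₀ h₁; rw [step_top_down_right (by omega) (by omega)]; ext <;> simp

theorem step_injective : Function.Injective D.step := fun σ τ h => by
  rw [← CState.rev_rev σ, ← CState.rev_rev τ, ← step_rev_step σ, ← step_rev_step τ, h]

theorem stepB_step (σ : CState) : D.stepB (D.step σ) = σ := by
  rw [stepB_eq, step_rev_step, CState.rev_rev]

/-- No lift of `β` is its own reverse, even up to deck transformations. -/
theorem iterate_step_ne_shift_rev (n : ℕ) (σ : CState) (m h : ℤ) :
    D.step^[n] σ ≠ D.shift m h σ.rev := by
  induction n using Nat.twoStepInduction generalizing σ with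
  | zero => intro e; have := congrArg CState.up e; simp at this
  | one =>
    rw [Function.iterate_one]
    have hq := D.qz_nonneg
    have hr := D.rz_nonneg
    have hp := D.two_qz_add_rz_le
    have key : ∀ a : ℤ, -D.pz < 2 * a + 1 → 2 * a + 1 < D.pz → 2 * a + 1 ≠ D.pz * m := by
      intro a h₁ h₂ e
      have h3 : m < 1 := by nlinarith
      have h4 : -1 < m := by nlinarith
      obtain rfl : m = 0 := by omega
      omega
    refine step_cases (P := fun σ τ => τ ≠ D.shift m h σ.rev) ?_ ?_ ?_ ?_ ?_ ?_ ?_ ?_ σ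
    · intro x h e; simpa using congrArg CState.top e
    · intro x h e; simpa using congrArg CState.top e
    · intro k t h _ _ e; simpa using congrArg CState.top e
    · intro k t h _ _ e
      refine key (D.rz + D.qz - 1 - k) (by omega) (by omega) ?_
      have := congrArg CState.pos e; simp at this; linarith
    · intro k t h _ _ e; simpa using congrArg CState.top e
    · intro k t h _ _ e
      refine key (D.qz - 1 - k) (by omega) (by omega) ?_
      have := congrArg CState.pos e; simp at this; linarith
    · intro k t h _ _ e; simpa using congrArg CState.top e
    · intro k t h _ _ e; simpa using congrArg CState.top e
  | more n ih _ =>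
    intro e
    refine ih (D.step σ) ?_
    apply step_injective
    rw [step_shift, step_rev_step, ← e, ← Function.iterate_succ_apply,
      ← Function.iterate_succ_apply' (f := D.step)]

end StdDiagram

namespace StdDiagram

variable {D : StdDiagram}

/-! ### Orientations of the curve `β` -/

theorem step_iterate_rev_step_iterate (n : ℕ) (σ : CState) :
    D.step^[n] (D.step^[n] σ).rev = σ.rev := by
  induction n generalizing σ with
  | zero => rfl
  | succ n ih =>
    rw [Function.iterate_succ_apply' (x := σ), Function.iterate_succ_apply, step_rev_step, ih]

theorem exists_eq_shift {σ τ : CState} (hpos : σ.pos % D.pz = τ.pos % D.pz)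
    (hup : σ.up = τ.up) (htop : σ.top = τ.top) : ∃ m h, σ = D.shift m h τ := by
  obtain ⟨m, hm⟩ := Int.ModEq.dvd (show τ.pos ≡ σ.pos [ZMOD D.pz] from hpos.symm)
  refine ⟨m, σ.ht - τ.ht, ?_⟩
  ext <;> simp [hup, htop]
  linarith

/-- Every state returns to one of its translates. -/
theorem exists_period (σ : CState) : ∃ N : ℕ, 0 < N ∧ ∃ m h, D.step^[N] σ = D.shift m h σ := by
  have hp := D.pz_pos
  let f : ℕ → Finset.Ico 0 D.pz × Bool × Bool := fun n =>
    (⟨(D.step^[n] σ).pos % D.pz, by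
      simp [Int.emod_nonneg _ hp.ne', Int.emod_lt_of_pos _ hp]⟩,
      (D.step^[n] σ).up, (D.step^[n] σ).top)
  obtain ⟨a, b, hab, hf⟩ : ∃ a b, a < b ∧ f a = f b := by
    obtain ⟨a, b, hne, hf⟩ := Finite.exists_ne_map_eq_of_infinite f
    rcases lt_or_gt_of_ne hne with h | h
    · exact ⟨a, b, h, hf⟩
    · exact ⟨b, a, h, hf.symm⟩
  simp only [f, Prod.mk.injEq, Subtype.mk.injEq] at hf
  obtain ⟨m, h, e⟩ := exists_eq_shift (D := D) hf.1.symm hf.2.1.symm hf.2.2.symm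
  refine ⟨b - a, by omega, m, h, ?_⟩
  apply step_injective.iterate a
  rw [← Function.iterate_add_apply, iterate_step_shift, ← e]
  congr 2; omega

/-- The index of the crossing with `α` through which the vertical strand carrying the
state passes. -/
def crossing (D : StdDiagram) (σ : CState) : ℤ := if σ.top then σ.pos else σ.pos - D.sz

/-- The state is traversed in the direction prescribed by `E`, which records for each
crossing of `α` and `β` whether `β` runs upwards there. -/
def Compat (D : StdDiagram) (E : ℤ → Bool) (σ : CState) : Prop := σ.up = E (D.crossing σ)

/-- The function `E` is an orientation of `β`, positive with respect to `α`. -/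
structure IsOrientation (D : StdDiagram) (E : ℤ → Bool) : Prop where
  add_pz : ∀ k, E (k + D.pz) = E k
  compat_step : ∀ σ, D.Compat E (D.step σ) ↔ D.Compat E σ
  transitive : ∀ σ τ, D.Compat E σ → D.Compat E τ → ∃ n m h, D.step^[n] σ = D.shift m h τ

/-- The states on the orbit of `start0`, up to deck transformations. -/
def InOrbit (D : StdDiagram) (σ : CState) : Prop :=
  ∃ n m h, σ = D.shift m h (D.step^[n] start0)

theorem InOrbit.shift {σ : CState} (hσ : D.InOrbit σ) (m h : ℤ) : D.InOrbit (D.shift m h σ) := by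
  obtain ⟨n, m', h', rfl⟩ := hσ
  exact ⟨n, _, _, shift_shift _ _ _ _ _⟩

theorem InOrbit.not_rev {σ : CState} (hσ : D.InOrbit σ) : ¬ D.InOrbit σ.rev := by
  suffices H : ∀ a b m h m' h', a ≤ b → ∀ σ : CState, σ = D.shift m h (D.step^[a] start0) →
      σ.rev ≠ D.shift m' h' (D.step^[b] start0) by
    rintro ⟨b, m', h', e'⟩
    obtain ⟨a, m, h, e⟩ := hσ
    rcases le_total a b with hab | hab
    · exact H a b m h m' h' hab σ e e'
    · exact H b a m' h' m h hab σ.rev e' (by rw [CState.rev_rev, e])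
  rintro a b m h m' h' hab σ rfl e
  refine iterate_step_ne_shift_rev (D := D) (b - a) (D.step^[a] start0) (m - m') (h - h') ?_
  rw [← Function.iterate_add_apply, Nat.sub_add_cancel hab]
  have := congrArg (D.shift (-m') (-h')) e
  rw [shift_shift, rev_shift, shift_shift] at this
  simp only [neg_add_cancel, shift_zero] at this
  rw [← this]; congr 1 <;> ring

theorem inOrbit_step {σ : CState} : D.InOrbit (D.step σ) ↔ D.InOrbit σ := by
  constructor
  · rintro ⟨n, m, h, e⟩
    obtain ⟨N, hN, m', h', e'⟩ := exists_period (D := D) start0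
    have e'' : D.step σ = D.shift (m - m') (h - h') (D.step^[n + N] start0) := by
      rw [Function.iterate_add_apply, e', iterate_step_shift, shift_shift, e]
      congr 1 <;> ring
    obtain ⟨k, hk⟩ : ∃ k, n + N = k + 1 := ⟨n + N - 1, by omega⟩
    rw [hk, Function.iterate_succ_apply', ← step_shift] at e''
    exact ⟨k, _, _, step_injective e''⟩
  · rintro ⟨n, m, h, rfl⟩
    exact ⟨n + 1, m, h, by rw [step_shift, Function.iterate_succ_apply']⟩

theorem InOrbit.transitive {σ τ : CState} (hσ : D.InOrbit σ) (hτ : D.InOrbit τ) :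
    ∃ n m h, D.step^[n] σ = D.shift m h τ := by
  obtain ⟨a, m, h, rfl⟩ := hσ
  obtain ⟨b, m', h', rfl⟩ := hτ
  obtain ⟨N, hN, m'', h'', e⟩ := exists_period (D := D) start0
  have key : ∀ k : ℕ, ∃ m h, D.step^[k * N] start0 = D.shift m h start0 := by
    intro k
    induction k with
    | zero => exact ⟨0, 0, by simp [shift_zero]⟩
    | succ k ih =>
      obtain ⟨m, h, ih⟩ := ih
      exact ⟨_, _, by rw [add_one_mul, Function.iterate_add_apply, e, iterate_step_shift, ih,
        shift_shift]⟩
  obtain ⟨x, y, hxy⟩ := key a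
  have hle : a ≤ b + a * N := by nlinarith
  refine ⟨b + a * N - a, m + x - m', h + y - h', ?_⟩
  rw [iterate_step_shift, ← Function.iterate_add_apply, Nat.sub_add_cancel hle,
    Function.iterate_add_apply, hxy, iterate_step_shift, shift_shift, shift_shift]
  congr 1 <;> ring

theorem upAt_iff_inOrbit (k h : ℤ) : D.UpAt k ↔ D.InOrbit ⟨k, true, true, h⟩ := by
  constructor
  · rintro ⟨n, h₁, h₂, h₃⟩
    obtain ⟨m, h', e⟩ := exists_eq_shift (D := D) (σ := ⟨k, true, true, h⟩) h₂.symm h₃.symm h₁.symm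
    exact ⟨n, m, h', e⟩
  · rintro ⟨n, m, h, e⟩
    refine ⟨n, ?_, ?_, ?_⟩
    · simpa using (congrArg CState.top e).symm
    · have := congrArg CState.pos e
      simp only [shift_pos] at this
      rw [this, Int.add_mul_emod_self_left]
    · simpa using (congrArg CState.up e).symm

theorem inOrbit_of_not_upAt (hconn : D.Connected) {k : ℤ} (hk : ¬ D.UpAt k) (h : ℤ) :
    D.InOrbit ⟨k, false, true, h⟩ := by
  have hp := D.pz_pos
  have h₀ := Int.emod_nonneg k hp.ne'
  have h₁ := Int.emod_lt_of_pos k hp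
  obtain ⟨n, h₂, h₃⟩ := hconn (k % D.pz).toNat (by
    have : D.pz = (D.p : ℤ) := rfl
    omega)
  rw [Int.toNat_of_nonneg h₀] at h₃
  have h₄ : (D.step^[n] start0).up = false := by
    by_contra h₄
    exact hk ⟨n, h₂, h₃, by simpa using h₄⟩
  obtain ⟨m, h', e⟩ := exists_eq_shift (D := D) (σ := ⟨k, false, true, h⟩) h₃.symm h₄.symm h₂.symm
  exact ⟨n, m, h', e⟩

theorem compat_upAt_iff (hconn : D.Connected) (σ : CState) :
    D.Compat (fun k => decide (D.UpAt k)) σ ↔ D.InOrbit σ := by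
  have htop : ∀ u k h, (u = decide (D.UpAt k)) ↔ D.InOrbit ⟨k, u, true, h⟩ := by
    intro u k h
    cases u
    · constructor
      · intro hk
        exact inOrbit_of_not_upAt hconn (by simpa using hk) h
      · intro ho
        have := ho.not_rev
        rw [show CState.rev ⟨k, false, true, h⟩ = ⟨k, true, true, h⟩ from rfl,
          ← upAt_iff_inOrbit] at this
        simpa using this
    · rw [← upAt_iff_inOrbit]; simp
  obtain ⟨x, u, b, h⟩ := σ
  cases b
  · rw [show D.Compat _ ⟨x, u, false, h⟩ ↔ (u = decide (D.UpAt (x - D.sz))) from Iff.rfl, htop u _ h]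
    cases u
    · rw [← inOrbit_step (σ := ⟨x, false, false, h⟩), step_bot_down]
    · rw [← inOrbit_step, step_top_up, sub_add_cancel]
  · exact htop u x h

theorem upAt_add_pz (k : ℤ) : D.UpAt (k + D.pz) ↔ D.UpAt k := by
  simp [UpAt]

theorem isOrientation_upAt (hconn : D.Connected) :
    D.IsOrientation fun k => decide (D.UpAt k) where
  add_pz k := by simp only [upAt_add_pz]
  compat_step σ := by rw [compat_upAt_iff hconn, compat_upAt_iff hconn, inOrbit_step]
  transitive σ τ hσ hτ := by
    rw [compat_upAt_iff hconn] at hσ hτ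
    exact hσ.transitive hτ

theorem IsOrientation.not {E : ℤ → Bool} (hE : D.IsOrientation E) :
    D.IsOrientation fun k => !E k := by
  have key : ∀ σ, D.Compat (fun k => !E k) σ ↔ D.Compat E σ.rev := by
    intro σ
    change (σ.up = !E (D.crossing σ)) ↔ ((!σ.up) = E (D.crossing σ))
    cases σ.up <;> cases E (D.crossing σ) <;> simp
  refine ⟨fun k => by simp only [hE.add_pz], fun σ => ?_, fun σ τ hσ hτ => ?_⟩
  · rw [key, key, ← hE.compat_step, step_rev_step]
  · rw [key] at hσ hτ
    obtain ⟨n, m, h, e⟩ := hE.transitive _ _ hτ hσ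
    have := step_iterate_rev_step_iterate (D := D) n τ.rev
    rw [e, rev_shift, CState.rev_rev, CState.rev_rev, iterate_step_shift] at this
    refine ⟨n, -m, -h, ?_⟩
    rw [← this, shift_shift]
    simp [shift_zero]

/-! ### Normalising the direction of `α · β` -/

/-- The orientation of `β` for which `α · β > 0`. -/
def orient (D : StdDiagram) (k : ℤ) : Bool := decide (D.TrueUpPt k)

/-- The state of the forward flow of `step` corresponding to a state of `fstep`. -/
def normalize (D : StdDiagram) (σ : CState) : CState := if 0 < D.algInt then σ else σ.rev

/-- The signed intersection number of `α` and `β` at a crossing. -/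
def sgn (E : ℤ → Bool) (k : ℤ) : ℤ := if E k then 1 else -1

theorem isOrientation_orient (hconn : D.Connected) : D.IsOrientation D.orient := by
  by_cases h : 0 < D.algInt
  · convert isOrientation_upAt hconn using 2 with k
    simp [orient, TrueUpPt, h]
  · convert (isOrientation_upAt hconn).not using 2 with k
    simp [orient, TrueUpPt, h]

theorem sum_sgn_orient_pos (hA : D.algInt ≠ 0) :
    0 < ∑ k ∈ Finset.range D.p, sgn D.orient (k : ℤ) := by
  by_cases h : 0 < D.algInt
  · convert h using 1
    rw [algInt]
    refine Finset.sum_congr rfl fun k _ => ?_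
    simp only [sgn, orient, TrueUpPt, h]
    by_cases hk : D.UpAt k <;> simp [hk]
  · have h' : 0 < - D.algInt := by omega
    convert h' using 1
    rw [algInt, ← Finset.sum_neg_distrib]
    refine Finset.sum_congr rfl fun k _ => ?_
    simp only [sgn, orient, TrueUpPt, h]
    by_cases hk : D.UpAt k <;> simp [hk]

theorem normalize_fstep (σ : CState) : D.normalize (D.fstep σ) = D.step (D.normalize σ) := by
  by_cases h : 0 < D.algInt
  · simp [normalize, fstep, h]
  · simp [normalize, fstep, h, stepB_eq]

theorem normalize_iterate_fstep (n : ℕ) (σ : CState) :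
    D.normalize (D.fstep^[n] σ) = D.step^[n] (D.normalize σ) := by
  induction n with
  | zero => rfl
  | succ n ih => rw [Function.iterate_succ_apply', normalize_fstep, ih,
      Function.iterate_succ_apply']

@[simp] theorem normalize_pos (σ : CState) : (D.normalize σ).pos = σ.pos := by
  rw [normalize]; split_ifs <;> rfl

@[simp] theorem isCross0_normalize (σ : CState) : IsCross0 (D.normalize σ) ↔ IsCross0 σ := by
  rw [normalize]; split_ifs <;> rfl

/-- The state at the crossing `k` of the line `α̃`, directed along `E`. -/
def base (E : ℤ → Bool) (k : ℤ) : CState := ⟨k, E k, true, 0⟩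

theorem normalize_spt (k : ℕ) : D.normalize (D.spt k) = base D.orient k := by
  by_cases h : 0 < D.algInt <;> by_cases hk : D.UpAt k <;>
    simp [normalize, spt, base, orient, TrueUpPt, h, hk, CState.rev]

theorem trueUp_spt (k : ℕ) : D.TrueUp (D.spt k) ↔ D.orient k = true := by
  by_cases h : 0 < D.algInt <;> by_cases hk : D.UpAt k <;>
    simp [TrueUp, spt, orient, TrueUpPt, h, hk]

theorem isCross0_iterate_fstep_spt (n k : ℕ) :
    IsCross0 (D.fstep^[n] (D.spt k)) ↔ IsCross0 (D.step^[n] (base D.orient k)) := by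
  rw [← normalize_spt, ← normalize_iterate_fstep, isCross0_normalize]

theorem pos_iterate_fstep_spt (n k : ℕ) :
    (D.fstep^[n] (D.spt k)).pos = (D.step^[n] (base D.orient k)).pos := by
  rw [← normalize_spt, ← normalize_iterate_fstep, normalize_pos]

variable {E : ℤ → Bool}

/-! ### A potential for the orientation -/

/-- The signed number of crossings with `α` on the interval from `0` to `k`. -/
def pot (E : ℤ → Bool) (k : ℤ) : ℤ :=
  ∑ i ∈ Finset.range k.toNat, sgn E i - ∑ i ∈ Finset.range (-k).toNat, sgn E (-(i + 1))

/-- The algebraic intersection number of `α` and `β`. -/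
def degree (D : StdDiagram) (E : ℤ → Bool) : ℤ := ∑ k ∈ Finset.range D.p, sgn E (k : ℤ)

/-- The holonomy of the potential along the vertical direction. -/
def slope (D : StdDiagram) (E : ℤ → Bool) : ℤ := pot E (-D.sz)

theorem pot_zero : pot E 0 = 0 := by simp [pot]

theorem pot_add_one (k : ℤ) : pot E (k + 1) = pot E k + sgn E k := by
  rcases lt_or_ge k 0 with h | h
  · obtain ⟨n, rfl⟩ : ∃ n : ℕ, k = -(n + 1) := ⟨(-k - 1).toNat, by omega⟩
    have h₁ : (-(n + 1 : ℤ) + 1).toNat = 0 := by omega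
    have h₂ : (-(-(n + 1 : ℤ) + 1)).toNat = n := by omega
    have h₃ : (-(n + 1 : ℤ)).toNat = 0 := by omega
    have h₄ : (-(-(n + 1 : ℤ))).toNat = n + 1 := by omega
    rw [pot, pot, h₁, h₂, h₃, h₄, Finset.sum_range_succ]
    ring
  · obtain ⟨n, rfl⟩ : ∃ n : ℕ, k = n := ⟨k.toNat, by omega⟩
    have h₁ : ((n : ℤ) + 1).toNat = n + 1 := by omega
    have h₂ : (-((n : ℤ) + 1)).toNat = 0 := by omega
    have h₃ : (-(n : ℤ)).toNat = 0 := by omega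
    rw [pot, pot, h₁, h₂, h₃, Int.toNat_natCast, Finset.sum_range_succ]
    ring

theorem sgn_add_pz (hE : D.IsOrientation E) (k : ℤ) : sgn E (k + D.pz) = sgn E k := by
  rw [sgn, sgn, hE.add_pz]

theorem pot_add_pz (hE : D.IsOrientation E) (k : ℤ) :
    pot E (k + D.pz) = pot E k + D.degree E := by
  have hs : ∀ k, pot E (k + 1 + D.pz) - pot E (k + 1) = pot E (k + D.pz) - pot E k := by
    intro k
    rw [add_right_comm, pot_add_one, pot_add_one, sgn_add_pz hE]
    ring
  have h₀ : pot E D.pz = D.degree E := by simp [pot, degree, pz]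
  have : pot E (k + D.pz) - pot E k = D.degree E := by
    induction k using Int.induction_on with
    | zero => simp [pot_zero, h₀]
    | succ n ih => rw [hs, ih]
    | pred n ih => rw [← ih, ← hs, sub_add_cancel]
  linarith

theorem pot_add_pz_mul (hE : D.IsOrientation E) (k t : ℤ) :
    pot E (k + D.pz * t) = pot E k + D.degree E * t := by
  induction t using Int.induction_on with
  | zero => simp
  | succ n ih =>
    have := pot_add_pz hE (k + D.pz * n)
    rw [mul_add, mul_one, ← add_assoc, this, ih]
    ring
  | pred n ih =>
    have := pot_add_pz hE (k + D.pz * (-n - 1))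
    rw [show k + D.pz * (-n - 1) + D.pz = k + D.pz * -n by ring, ih] at this
    linarith

theorem pot_translate {a b : ℤ} {n : ℕ}
    (h : ∀ j : ℕ, j < n → sgn E (a + j) = sgn E (b + j)) :
    pot E (a + n) - pot E (b + n) = pot E a - pot E b := by
  induction n with
  | zero => simp
  | succ n ih =>
    have := h n (by omega)
    push_cast
    rw [← add_assoc, ← add_assoc, pot_add_one, pot_add_one, this, ← ih fun j hj => h j (by omega)]
    ring

theorem pot_reflect {a : ℤ} {n : ℕ}
    (h : ∀ j : ℕ, j < n → sgn E (a + j) = - sgn E (a + n - 1 - j)) {j : ℕ} (hj : j ≤ n) :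
    pot E (a + j) = pot E (a + n - j) := by
  have key : ∀ j : ℕ, j ≤ n →
      pot E (a + j) - pot E (a + n - j) = pot E a - pot E (a + n) := by
    intro j hj
    induction j with
    | zero => simp
    | succ j ih =>
      have h₁ := h j (by omega)
      have h₂ := pot_add_one (E := E) (a + j)
      have h₃ := pot_add_one (E := E) (a + n - 1 - j)
      rw [show a + n - 1 - (j : ℤ) + 1 = a + n - j by ring] at h₃
      have := ih (by omega)
      push_cast
      rw [← add_assoc, show a + n - ((j : ℤ) + 1) = a + n - 1 - j by ring]
      linarith
  have h₁ := key n le_rfl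
  have h₂ := key j hj
  rw [add_sub_cancel_right] at h₁
  linarith

/-! ### The orientation along the arcs of `β` -/

theorem compat_top_iff (x h : ℤ) (u : Bool) : D.Compat E ⟨x, u, true, h⟩ ↔ u = E x := Iff.rfl

theorem compat_bot_iff (x h : ℤ) (u : Bool) :
    D.Compat E ⟨x, u, false, h⟩ ↔ u = E (x - D.sz) := Iff.rfl

theorem orientation_left (hE : D.IsOrientation E) {m : ℤ} (h₀ : 0 ≤ m) (h₁ : m < D.rz) :
    E (m + 2 * D.qz - D.sz) = E m := by
  have h := hE.compat_step ⟨m, false, true, 0⟩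
  have h' := step_top_down_left (D := D) h₀ h₁ 0 0
  rw [mul_zero, add_zero, add_zero] at h'
  rw [h', compat_bot_iff, compat_top_iff] at h
  revert h; cases E m <;> cases E (m + 2 * D.qz - D.sz) <;> simp

theorem orientation_right (hE : D.IsOrientation E) {m : ℤ} (h₀ : D.rz + 2 * D.qz ≤ m)
    (h₁ : m < D.pz) : E (m - D.sz) = E m := by
  have h := hE.compat_step ⟨m, false, true, 0⟩
  have h' := step_top_down_right (D := D) h₀ h₁ 0 0
  rw [mul_zero, add_zero] at h'
  rw [h', compat_bot_iff, compat_top_iff] at h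
  revert h; cases E m <;> cases E (m - D.sz) <;> simp

theorem orientation_top_arc (hE : D.IsOrientation E) {m : ℤ} (h₀ : D.rz ≤ m)
    (h₁ : m < D.rz + 2 * D.qz) : E (2 * D.rz + 2 * D.qz - 1 - m) = !E m := by
  have h := hE.compat_step ⟨m, false, true, 0⟩
  have h' := step_top_down_arc (D := D) h₀ h₁ 0 0
  rw [mul_zero, add_zero, add_zero] at h'
  rw [h', compat_top_iff, compat_top_iff] at h
  revert h; cases E m <;> cases E (2 * D.rz + 2 * D.qz - 1 - m) <;> simp

theorem orientation_bot_arc (hE : D.IsOrientation E) {m : ℤ} (h₀ : 0 ≤ m)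
    (h₁ : m < 2 * D.qz) : E (2 * D.qz - 1 - m - D.sz) = !E (m - D.sz) := by
  have h := hE.compat_step ⟨m, true, false, 0⟩
  have h' := step_bot_up_arc (D := D) h₀ h₁ 0 0
  rw [mul_zero, add_zero, add_zero] at h'
  rw [h', compat_bot_iff, compat_bot_iff] at h
  revert h; cases E (m - D.sz) <;> cases E (2 * D.qz - 1 - m - D.sz) <;> simp

theorem sgn_congr {k l : ℤ} (h : E k = E l) : sgn E k = sgn E l := by rw [sgn, sgn, h]

theorem sgn_not {k l : ℤ} (h : E k = !E l) : sgn E k = - sgn E l := by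
  rw [sgn, sgn, h]; cases E l <;> simp

theorem pot_top_arc (hE : D.IsOrientation E) {m : ℤ} (h₀ : D.rz ≤ m)
    (h₁ : m < D.rz + 2 * D.qz) : pot E (2 * D.rz + 2 * D.qz - 1 - m) = pot E (m + 1) := by
  have hn : ((2 * D.q : ℕ) : ℤ) = 2 * D.qz := by simp [qz]
  have := pot_reflect (E := E) (a := D.rz) (n := 2 * D.q) (j := (m + 1 - D.rz).toNat)
    (fun j hj => by
      rw [hn]
      rw [← sub_eq_zero, sub_neg_eq_add, add_comm, ← sub_neg_eq_add, sub_eq_zero]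
      refine sgn_not ?_
      rw [← orientation_top_arc hE (by omega) (by omega)]
      congr 1; ring) (by omega)
  rw [hn, Int.toNat_of_nonneg (by omega)] at this
  rw [show m + 1 = D.rz + (m + 1 - D.rz) by ring, this]
  congr 1; ring

theorem pot_bot_arc (hE : D.IsOrientation E) {m : ℤ} (h₀ : 0 ≤ m)
    (h₁ : m ≤ 2 * D.qz) : pot E (2 * D.qz - m - D.sz) = pot E (m - D.sz) := by
  have hn : ((2 * D.q : ℕ) : ℤ) = 2 * D.qz := by simp [qz]
  have := pot_reflect (E := E) (a := -D.sz) (n := 2 * D.q) (j := m.toNat)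
    (fun j hj => by
      rw [hn]
      rw [← sub_eq_zero, sub_neg_eq_add, add_comm, ← sub_neg_eq_add, sub_eq_zero]
      refine sgn_not ?_
      rw [show -D.sz + (j : ℤ) = j - D.sz by ring, ← orientation_bot_arc hE (by omega) (by omega)]
      congr 1; ring) (by omega)
  rw [hn, Int.toNat_of_nonneg h₀] at this
  rw [show m - D.sz = -D.sz + m by ring, this]
  congr 1; ring

theorem pot_left (hE : D.IsOrientation E) {m : ℤ} (h₀ : 0 ≤ m) (h₁ : m ≤ D.rz) :
    pot E (m + 2 * D.qz - D.sz) = pot E m + D.slope E := by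
  have := pot_translate (E := E) (a := 2 * D.qz - D.sz) (b := 0) (n := m.toNat) (fun j hj => by
    refine sgn_congr ?_
    rw [← orientation_left hE (m := 0 + (j : ℤ)) (by omega) (by omega)]
    congr 1; ring)
  have h := pot_bot_arc hE (m := 0) le_rfl (by have := D.qz_nonneg; omega)
  rw [sub_zero, zero_sub] at h
  rw [Int.toNat_of_nonneg h₀, pot_zero, h, zero_add] at this
  rw [slope, show m + 2 * D.qz - D.sz = 2 * D.qz - D.sz + m by ring]
  linarith

theorem pot_right (hE : D.IsOrientation E) {m : ℤ} (h₀ : D.rz + 2 * D.qz ≤ m)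
    (h₁ : m ≤ D.pz) : pot E (m - D.sz) = pot E m + D.slope E := by
  have := pot_translate (E := E) (a := D.rz + 2 * D.qz - D.sz) (b := D.rz + 2 * D.qz)
    (n := (m - (D.rz + 2 * D.qz)).toNat) (fun j hj => by
      refine sgn_congr ?_
      rw [← orientation_right hE (m := D.rz + 2 * D.qz + (j : ℤ)) (by omega) (by omega)]
      congr 1; ring)
  have h := pot_left hE D.rz_nonneg le_rfl
  have h' : pot E (D.rz + 2 * D.qz) = pot E D.rz := by
    rcases D.qz_nonneg.eq_or_lt with hq | hq
    · rw [← hq]; simp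
    · have := pot_top_arc hE (m := D.rz + 2 * D.qz - 1) (by omega) (by omega)
      rw [sub_add_cancel] at this
      rw [← this]; congr 1; ring
  rw [Int.toNat_of_nonneg (by omega), h, h'] at this
  rw [show m - D.sz = D.rz + 2 * D.qz - D.sz + (m - (D.rz + 2 * D.qz)) by ring]
  rw [add_sub_cancel] at this
  linarith

/-! ### The level of a state -/

/-- The value of the potential on the region to the left of the state; it is constant
along every lift of `β`. -/
def level (D : StdDiagram) (E : ℤ → Bool) (σ : CState) : ℤ :=
  (if σ.up then pot E (D.crossing σ) else pot E (D.crossing σ + 1)) + D.slope E * σ.ht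

theorem level_shift (hE : D.IsOrientation E) (m h : ℤ) (σ : CState) :
    D.level E (D.shift m h σ) = D.level E σ + D.degree E * m + D.slope E * h := by
  have hc : D.crossing (D.shift m h σ) = D.crossing σ + D.pz * m := by
    rw [crossing, crossing, shift_top, shift_pos]; split_ifs <;> ring
  rw [level, level, hc, shift_up, shift_ht, add_right_comm, pot_add_pz_mul hE, pot_add_pz_mul hE]
  split_ifs <;> ring

theorem level_step (hE : D.IsOrientation E) (σ : CState) :
    D.level E (D.step σ) = D.level E σ := by
  refine step_cases (P := fun σ τ => D.level E τ = D.level E σ) ?_ ?_ ?_ ?_ ?_ ?_ ?_ ?_ σ <;>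
    simp only [level, crossing, Bool.false_eq_true, reduceIte]
  · intro x h; rw [add_sub_cancel_right]
  · intro x h; trivial
  · intro m t h h₀ h₁
    have := pot_left hE (m := m + 1) (by omega) (by omega)
    rw [show m + 2 * D.qz + D.pz * t - D.sz + 1 = m + 1 + 2 * D.qz - D.sz + D.pz * t by ring,
      show m + D.pz * t + 1 = m + 1 + D.pz * t by ring, pot_add_pz_mul hE, pot_add_pz_mul hE, this]
    ring
  · intro m t h h₀ h₁
    have := pot_top_arc hE h₀ h₁
    rw [show m + D.pz * t + 1 = m + 1 + D.pz * t by ring, pot_add_pz_mul hE, pot_add_pz_mul hE,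
      this]
  · intro m t h h₀ h₁
    have := pot_right hE (m := m + 1) (by omega) (by omega)
    rw [show m + D.pz * t - D.sz + 1 = m + 1 - D.sz + D.pz * t by ring,
      show m + D.pz * t + 1 = m + 1 + D.pz * t by ring, pot_add_pz_mul hE, pot_add_pz_mul hE, this]
    ring
  · intro m t h h₀ h₁
    have := pot_bot_arc hE (m := m) (by omega) (by omega)
    rw [show 2 * D.qz - 1 - m + D.pz * t - D.sz + 1 = 2 * D.qz - m - D.sz + D.pz * t by ring,
      show m + D.pz * t - D.sz = m - D.sz + D.pz * t by ring, pot_add_pz_mul hE,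
      pot_add_pz_mul hE, this]
  · intro m t h h₀ h₁
    have := pot_left hE (m := m - 2 * D.qz) (by omega) (by omega)
    rw [sub_add_cancel] at this
    rw [show m + D.pz * t - D.sz = m - D.sz + D.pz * t by ring, pot_add_pz_mul hE,
      pot_add_pz_mul hE, this]
    ring
  · intro m t h h₀ h₁
    have := pot_right hE (m := m) (by omega) (by omega)
    rw [show m + D.pz * t - D.sz = m - D.sz + D.pz * t by ring, pot_add_pz_mul hE,
      pot_add_pz_mul hE, this]
    ring

theorem level_iterate_step (hE : D.IsOrientation E) (n : ℕ) (σ : CState) :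
    D.level E (D.step^[n] σ) = D.level E σ := by
  induction n with
  | zero => rfl
  | succ n ih => rw [Function.iterate_succ_apply', level_step hE, ih]

/-! ### The period of a lift -/

theorem orientation_add_pz_mul (hE : D.IsOrientation E) (k t : ℤ) : E (k + D.pz * t) = E k := by
  induction t using Int.induction_on with
  | zero => simp
  | succ n ih => rw [mul_add, mul_one, ← add_assoc, hE.add_pz, ih]
  | pred n ih =>
    rw [← ih, ← hE.add_pz]; congr 1; ring

theorem orientation_congr (hE : D.IsOrientation E) {k l : ℤ} (h : k % D.pz = l % D.pz) :
    E k = E l := by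
  obtain ⟨t, ht⟩ := Int.ModEq.dvd (show l ≡ k [ZMOD D.pz] from h.symm)
  rw [show k = l + D.pz * t by linarith, orientation_add_pz_mul hE]

theorem compat_shift (hE : D.IsOrientation E) (m h : ℤ) (σ : CState) :
    D.Compat E (D.shift m h σ) ↔ D.Compat E σ := by
  have : E (D.crossing (D.shift m h σ)) = E (D.crossing σ) := by
    rw [← orientation_add_pz_mul hE (D.crossing σ) m]
    congr 1
    rw [crossing, crossing, shift_top, shift_pos]; split_ifs <;> ring
  rw [Compat, Compat, this, shift_up]

theorem compat_iterate_step (hE : D.IsOrientation E) (n : ℕ) (σ : CState) :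
    D.Compat E (D.step^[n] σ) ↔ D.Compat E σ := by
  induction n with
  | zero => rfl
  | succ n ih => rw [Function.iterate_succ_apply', hE.compat_step, ih]

theorem compat_base (k : ℤ) : D.Compat E (base E k) := rfl

theorem Compat.exists_eq_shift (hE : D.IsOrientation E) {σ τ : CState} (hσ : D.Compat E σ)
    (hτ : D.Compat E τ) (hpos : σ.pos % D.pz = τ.pos % D.pz) (htop : σ.top = τ.top) :
    ∃ m h, σ = D.shift m h τ := by
  refine StdDiagram.exists_eq_shift hpos ?_ htop
  rw [hσ, hτ, crossing, crossing, htop]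
  split_ifs
  · exact orientation_congr hE hpos
  · exact orientation_congr hE (Int.ModEq.sub_right D.sz hpos)

/-- The change of row along one piece of `β`, starting at the given label. -/
def rowStep (D : StdDiagram) (E : ℤ → Bool) (k : ℤ) (top : Bool) : ℤ :=
  if top then (if E k then 1 else 0) else (if E (k - D.sz) then 0 else -1)

theorem row_step (hE : D.IsOrientation E) {σ : CState} (hσ : D.Compat E σ) :
    (D.step σ).row = σ.row + D.rowStep E (σ.pos % D.pz) σ.top := by
  have h₁ : E (σ.pos % D.pz) = E σ.pos := orientation_congr hE (Int.emod_emod_of_dvd _ dvd_rfl)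
  have h₂ : E (σ.pos % D.pz - D.sz) = E (σ.pos - D.sz) :=
    orientation_congr hE (Int.ModEq.sub_right D.sz (Int.emod_emod_of_dvd _ dvd_rfl))
  rw [rowStep, h₁, h₂]
  clear h₁ h₂
  revert hσ
  refine step_cases (P := fun σ τ => D.Compat E σ → τ.row = σ.row + if σ.top = true then
    (if E σ.pos = true then 1 else 0) else if E (σ.pos - D.sz) = true then 0 else -1)
    ?_ ?_ ?_ ?_ ?_ ?_ ?_ ?_ σ
  all_goals
    intros
    rename_i hc
    simp only [Compat, crossing, Bool.false_eq_true, reduceIte] at hc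
    simp [CState.row, ← hc]
  all_goals ring

theorem sum_sgn_range (a : ℤ) (n : ℕ) :
    ∑ k ∈ Finset.range n, sgn E (a + k) = pot E (a + n) - pot E a := by
  induction n with
  | zero => simp
  | succ n ih =>
    rw [Finset.sum_range_succ, ih]
    push_cast
    rw [← add_assoc, pot_add_one]
    ring

theorem sum_rowStep (hE : D.IsOrientation E) :
    ∑ x ∈ Finset.range D.p ×ˢ (Finset.univ : Finset Bool), D.rowStep E x.1 x.2 = D.degree E := by
  have h₁ : ∀ k : ℤ, 2 * ∑ b : Bool, D.rowStep E k b = sgn E k + sgn E (-D.sz + k) := by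
    intro k
    rw [neg_add_eq_sub, Fintype.sum_bool]
    simp only [rowStep, sgn, Bool.false_eq_true, reduceIte]
    split_ifs <;> norm_num
  have h₂ := sum_sgn_range (E := E) (-D.sz) D.p
  rw [show (D.p : ℤ) = D.pz from rfl, pot_add_pz hE, add_sub_cancel_left] at h₂
  have h₃ : 2 * ∑ x ∈ Finset.range D.p ×ˢ (Finset.univ : Finset Bool), D.rowStep E x.1 x.2 =
      2 * D.degree E := by
    rw [Finset.sum_product, Finset.mul_sum, Finset.sum_congr rfl fun (k : ℕ) _ => h₁ k,
      Finset.sum_add_distrib, h₂, degree]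
    ring
  linarith

theorem exists_compat (k : ℤ) (b : Bool) :
    ∃ τ : CState, D.Compat E τ ∧ τ.pos = k ∧ τ.top = b := by
  cases b
  · exact ⟨⟨k, E (k - D.sz), false, 0⟩, rfl, rfl, rfl⟩
  · exact ⟨⟨k, E k, true, 0⟩, rfl, rfl, rfl⟩

theorem row_iterate_step (hE : D.IsOrientation E) {σ : CState} (hσ : D.Compat E σ) (n : ℕ) :
    (D.step^[n] σ).row = σ.row +
      ∑ i ∈ Finset.range n, D.rowStep E ((D.step^[i] σ).pos % D.pz) (D.step^[i] σ).top := by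
  induction n with
  | zero => simp
  | succ n ih =>
    rw [Function.iterate_succ_apply', row_step hE ((compat_iterate_step hE n σ).2 hσ), ih,
      Finset.sum_range_succ, add_assoc]

theorem exists_period_of_base (hE : D.IsOrientation E) :
    ∃ N : ℕ, 0 < N ∧ ∃ m, D.step^[N] (base E 0) = D.shift m (D.degree E) (base E 0) := by
  have hp := D.pz_pos
  have hpz : D.pz = (D.p : ℤ) := rfl
  set σ := base E 0 with hσdef
  have hσ : D.Compat E σ := compat_base 0
  have hσn : ∀ n, D.Compat E (D.step^[n] σ) := fun n => (compat_iterate_step hE n σ).2 hσ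
  let N := Nat.find (exists_period (D := D) σ)
  obtain ⟨hN, m, h, e⟩ := Nat.find_spec (exists_period (D := D) σ)
  have hmin : ∀ n, 0 < n → n < N → ∀ m h, D.step^[n] σ ≠ D.shift m h σ := fun n h₀ h₁ m h e =>
    Nat.find_min (exists_period (D := D) σ) h₁ ⟨h₀, m, h, e⟩
  change 0 < N at hN
  change D.step^[N] σ = _ at e
  let key : ℕ → ℕ × Bool := fun n =>
    (((D.step^[n] σ).pos % D.pz).toNat, (D.step^[n] σ).top)
  have hpos : ∀ x : ℤ, ((x % D.pz).toNat : ℤ) = x % D.pz := fun x =>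
    Int.toNat_of_nonneg (Int.emod_nonneg x hp.ne')
  have hinj : ∀ a b, a < b → b < N → key a ≠ key b := by
    intro a b hab hb he
    simp only [key, Prod.mk.injEq] at he
    have h₁ : (D.step^[b] σ).pos % D.pz = (D.step^[a] σ).pos % D.pz := by
      rw [← hpos (D.step^[b] σ).pos, ← hpos (D.step^[a] σ).pos, he.1]
    obtain ⟨m, h, e'⟩ := (hσn b).exists_eq_shift hE (hσn a) h₁ he.2.symm
    refine hmin (b - a) (by omega) (by omega) m h ?_
    apply step_injective.iterate a
    rw [← Function.iterate_add_apply, iterate_step_shift, ← e']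
    congr 2; omega
  have hmod : ∀ n, ∃ x y, D.step^[n] σ = D.shift x y (D.step^[n % N] σ) := by
    intro n
    induction n using Nat.strong_induction_on with
    | _ n ih =>
      rcases lt_or_ge n N with hn | hn
      · exact ⟨0, 0, by rw [Nat.mod_eq_of_lt hn, shift_zero]⟩
      · obtain ⟨x, y, hxy⟩ := ih (n - N) (by omega)
        refine ⟨m + x, h + y, ?_⟩
        rw [← shift_shift, Nat.mod_eq_sub_mod hn, ← hxy, ← iterate_step_shift, ← e,
          ← Function.iterate_add_apply, Nat.sub_add_cancel hn]
  have hsum := row_iterate_step hE hσ N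
  have hbij : ∑ i ∈ Finset.range N, D.rowStep E ((D.step^[i] σ).pos % D.pz) (D.step^[i] σ).top =
      ∑ x ∈ Finset.range D.p ×ˢ (Finset.univ : Finset Bool), D.rowStep E x.1 x.2 := by
    refine Finset.sum_nbij key ?_ ?_ ?_ ?_
    · intro i _
      have := Int.emod_lt_of_pos (D.step^[i] σ).pos hp
      simp only [key, Finset.mem_product, Finset.mem_range, Finset.mem_univ, and_true]
      omega
    · intro a ha b hb hab
      rw [Finset.coe_range, Set.mem_Iio] at ha hb
      rcases lt_trichotomy a b with h | h | h
      · exact (hinj a b h hb hab).elim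
      · exact h
      · exact (hinj b a h ha hab.symm).elim
    · rintro ⟨k, b⟩ hk
      have hk' : k < D.p := by simpa using hk
      obtain ⟨τ, hτ, rfl₁, rfl₂⟩ := exists_compat (D := D) (E := E) k b
      obtain ⟨n, x, y, e'⟩ := hE.transitive _ _ hσ hτ
      obtain ⟨x', y', e''⟩ := hmod n
      refine ⟨n % N, by simpa using Nat.mod_lt n hN, ?_⟩
      rw [e''] at e'
      have h₁ := congrArg CState.top e'
      have h₂ := congrArg (fun σ => CState.pos σ % D.pz) e'
      simp only [shift_top, shift_pos, Int.add_mul_emod_self_left, rfl₁, rfl₂] at h₁ h₂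
      simp only [key, Prod.mk.injEq]
      refine ⟨?_, h₁⟩
      rw [h₂, Int.emod_eq_of_lt (by omega) (by omega), Int.toNat_natCast]
    · intro i _
      simp only [key, hpos]
  rw [hbij, sum_rowStep hE, e, row_shift] at hsum
  obtain rfl : h = D.degree E := by linarith
  exact ⟨N, hN, m, e⟩

/-- Every lift of `β` is invariant under one and the same deck transformation, which is
primitive in the sense that it moves by the intersection number of `α` and `β`. -/
theorem exists_common_period (hE : D.IsOrientation E) (hd : 0 < D.degree E) :
    ∃ N : ℕ, 0 < N ∧ ∀ σ, D.Compat E σ →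
      D.step^[N] σ = D.shift (-D.slope E) (D.degree E) σ := by
  obtain ⟨N, hN, m, e⟩ := exists_period_of_base hE
  have hm : m = -D.slope E := by
    have := level_iterate_step hE N (base E 0)
    rw [e, level_shift hE] at this
    have : D.degree E * (m + D.slope E) = 0 := by linarith
    rcases mul_eq_zero.1 this with h | h
    · exact (hd.ne' h).elim
    · linarith
  subst hm
  refine ⟨N, hN, fun σ hσ => ?_⟩
  obtain ⟨n, m', h', e'⟩ := hE.transitive _ _ (compat_base 0) hσ
  have h₁ : D.step^[N] (D.shift m' h' σ) =
      D.shift (-D.slope E) (D.degree E) (D.shift m' h' σ) := by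
    rw [← e', ← Function.iterate_add_apply, add_comm, Function.iterate_add_apply, e,
      iterate_step_shift]
  rw [iterate_step_shift] at h₁
  have h₂ := congrArg (D.shift (-m') (-h')) h₁
  simp only [shift_shift, neg_add_cancel, shift_zero] at h₂
  rw [h₂]
  congr 1 <;> ring

/-! ### Intersection points on a common lift -/

/-- The lift of `β` through the crossing `a` of `α̃` later meets `α̃` at a translate of `c`. -/
def Reaches (D : StdDiagram) (E : ℤ → Bool) (a c : ℤ) : Prop :=
  ∃ n m, D.step^[n] (base E a) = D.shift m 0 (base E c)

theorem Compat.eq_shift_base (hE : D.IsOrientation E) {σ : CState} (hσ : D.Compat E σ)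
    (hc : σ.top = true) {k : ℤ} (hk : σ.pos % D.pz = k % D.pz) :
    ∃ m, σ = D.shift m σ.ht (base E k) := by
  obtain ⟨m, h, e⟩ := hσ.exists_eq_shift hE (compat_base k) hk hc
  obtain rfl : h = σ.ht := by rw [e]; simp [base]
  exact ⟨m, e⟩

theorem reach_iff (hE : D.IsOrientation D.orient) {a c : ℕ} (hc : c < D.p) :
    D.Reach a c ↔ D.Reaches D.orient a c := by
  have hc' : (c : ℤ) % D.pz = c := Int.emod_eq_of_lt (by omega) (by
    have : D.pz = (D.p : ℤ) := rfl
    omega)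
  constructor
  · rintro ⟨n, h₁, h₂⟩
    rw [isCross0_iterate_fstep_spt] at h₁
    rw [pos_iterate_fstep_spt, ← hc'] at h₂
    have hn : D.Compat D.orient (D.step^[n] (base D.orient a)) :=
      (compat_iterate_step hE n _).2 (compat_base _)
    obtain ⟨m, e⟩ := hn.eq_shift_base hE h₁.1 h₂
    rw [h₁.2] at e
    exact ⟨n, m, e⟩
  · rintro ⟨n, m, e⟩
    refine ⟨n, ?_, ?_⟩
    · rw [isCross0_iterate_fstep_spt, e]
      exact ⟨rfl, rfl⟩
    · rw [pos_iterate_fstep_spt, e, shift_pos, Int.add_mul_emod_self_left]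
      exact hc'

theorem exists_consecutive_up (hE : D.IsOrientation E) (hd : 0 < D.degree E) :
    ∃ k, E k = true ∧ E (k + 1) = true := by
  by_contra! H
  have hstep : ∀ k, pot E (k + 2) ≤ pot E k := by
    intro k
    rw [show k + 2 = k + 1 + 1 by ring, pot_add_one, pot_add_one, sgn, sgn]
    have := H k
    split_ifs <;> simp_all
  have hle : ∀ n : ℕ, pot E (2 * n) ≤ 0 := by
    intro n
    induction n with
    | zero => simp [pot_zero]
    | succ n ih =>
      have := hstep (2 * n)
      push_cast
      rw [mul_add, mul_one]
      linarith
  have := pot_add_pz_mul hE 0 2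
  rw [zero_add, pot_zero, zero_add, mul_comm] at this
  have h2 := hle D.p
  rw [show (D.p : ℤ) = D.pz from rfl, this] at h2
  linarith

theorem isCoprime_degree_slope (hE : D.IsOrientation E) (hd : 0 < D.degree E) :
    IsCoprime (D.degree E) (D.slope E) := by
  rw [Int.isCoprime_iff_gcd_eq_one]
  obtain ⟨k, h₁, h₂⟩ := exists_consecutive_up hE hd
  obtain ⟨n, m, h, e⟩ := hE.transitive _ _ (compat_base k) (compat_base (k + 1))
  have hl := level_iterate_step hE n (base E k)
  rw [e, level_shift hE] at hl
  simp only [level, base, h₁, h₂, crossing, reduceIte, pot_add_one] at hl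
  have h₃ : (Int.gcd (D.degree E) (D.slope E) : ℤ) ∣ D.degree E * m + D.slope E * h :=
    dvd_add ((Int.gcd_dvd_left _ _).mul_right _) ((Int.gcd_dvd_right _ _).mul_right _)
  have h₄ : sgn E k = 1 := by simp [sgn, h₁]
  rw [show D.degree E * m + D.slope E * h = -1 by linarith] at h₃
  have := Int.natCast_dvd.1 h₃
  simpa using this

theorem exists_multiple_period (hE : D.IsOrientation E) (hd : 0 < D.degree E) (t : ℕ) :
    ∃ N : ℕ, t ≤ N ∧ ∀ σ, D.Compat E σ →
      D.step^[N] σ = D.shift (-D.slope E * t) (D.degree E * t) σ := by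
  obtain ⟨N, hN, e⟩ := exists_common_period hE hd
  refine ⟨N * t, Nat.le_mul_of_pos_left _ hN, fun σ hσ => ?_⟩
  induction t with
  | zero => simp [shift_zero]
  | succ t ih =>
    rw [mul_add_one, add_comm, Function.iterate_add_apply, ih, iterate_step_shift, e σ hσ,
      shift_shift]
    push_cast
    congr 1 <;> ring

/-- Two intersection points lie on a common lift of `β` exactly if their levels agree
modulo the intersection number of `α` and `β`. -/
theorem reaches_or_reaches_iff (hE : D.IsOrientation E) (hd : 0 < D.degree E) (a c : ℤ) :
    (D.Reaches E a c ∨ D.Reaches E c a) ↔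
      D.level E (base E a) ≡ D.level E (base E c) [ZMOD D.degree E] := by
  have hlevel : ∀ {a c}, D.Reaches E a c →
      D.level E (base E a) ≡ D.level E (base E c) [ZMOD D.degree E] := by
    rintro a c ⟨n, m, e⟩
    have := level_iterate_step hE n (base E a)
    rw [e, level_shift hE, mul_zero, add_zero] at this
    rw [← this]
    exact (Int.modEq_iff_dvd.2 ⟨-m, by ring⟩)
  constructor
  · rintro (h | h)
    · exact hlevel h
    · exact (hlevel h).symm
  intro hl
  obtain ⟨n, m, h, e⟩ := hE.transitive _ _ (compat_base a) (compat_base c)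
  have hdvd : D.degree E ∣ h := by
    have h₁ := level_iterate_step hE n (base E a)
    rw [e, level_shift hE] at h₁
    obtain ⟨x, hx⟩ := Int.modEq_iff_dvd.1 hl
    exact (isCoprime_degree_slope hE hd).dvd_of_dvd_mul_left ⟨-x - m, by linarith⟩
  obtain ⟨t, rfl⟩ := hdvd
  rcases le_total t 0 with ht | ht
  · obtain ⟨u, rfl⟩ : ∃ u : ℕ, t = -u := ⟨(-t).toNat, by omega⟩
    obtain ⟨N, -, eN⟩ := exists_multiple_period hE hd u
    refine Or.inl ⟨N + n, m + -D.slope E * u, ?_⟩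
    rw [Function.iterate_add_apply, e, iterate_step_shift, eN _ (compat_base c), shift_shift]
    congr 1; ring
  · obtain ⟨u, rfl⟩ : ∃ u : ℕ, t = u := ⟨t.toNat, by omega⟩
    obtain ⟨N, -, eN⟩ := exists_multiple_period hE hd u
    have e' : D.step^[n] (base E a) =
        D.shift (m + D.slope E * u) 0 (D.step^[N] (base E c)) := by
      rw [e, eN _ (compat_base c), shift_shift]
      congr 1 <;> ring
    rcases le_total n N with hn | hn
    · refine Or.inr ⟨N - n, -(m + D.slope E * u), ?_⟩
      apply step_injective.iterate n
      rw [iterate_step_shift, e', ← Function.iterate_add_apply, Nat.add_sub_cancel' hn, shift_shift,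
        neg_add_cancel, add_zero, shift_zero]
    · refine Or.inl ⟨n - N, m + D.slope E * u, ?_⟩
      apply step_injective.iterate N
      rw [← Function.iterate_add_apply, Nat.add_sub_cancel' hn, iterate_step_shift, e']

theorem sameClass_iff (hE : D.IsOrientation D.orient) (hd : 0 < D.degree D.orient) {a c : ℕ}
    (ha : a < D.p) (hc : c < D.p) :
    D.SameClass a c ↔ D.level D.orient (base D.orient a) ≡ D.level D.orient (base D.orient c)
      [ZMOD D.degree D.orient] := by
  rw [SameClass, reach_iff hE hc, reach_iff hE ha, reaches_or_reaches_iff hE hd]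

/-! ### Compact arcs cut off by a lift of `α` -/

theorem row_step_of_top_up {σ : CState} (ht : σ.top = true) (hu : σ.up = true) :
    (D.step σ).row = σ.row + 1 := by
  obtain ⟨x, u, b, h⟩ := σ
  subst ht hu
  simp [step_top_up, CState.row]

theorem row_step_le {σ : CState} (h : ¬ (σ.top = true ∧ σ.up = true)) :
    (D.step σ).row ≤ σ.row := by
  revert h
  refine step_cases (P := fun σ τ => ¬ (σ.top = true ∧ σ.up = true) → τ.row ≤ σ.row)
    ?_ ?_ ?_ ?_ ?_ ?_ ?_ ?_ σ <;> intros <;> simp_all [CState.row]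

theorem row_of_step_top_down {σ : CState} (ht : (D.step σ).top = true)
    (hu : (D.step σ).up = false) : σ.row = (D.step σ).ht := by
  have h := stepB_step (D := D) σ
  rw [stepB_eq] at h
  generalize D.step σ = τ at *
  obtain ⟨x, u, b, k⟩ := τ
  subst ht hu
  rw [← h]
  simp [CState.rev, step_top_up, CState.row]

theorem exists_upward_crossing {σ : CState} {n : ℕ} {g : ℤ} (h₀ : σ.row < g)
    (h₁ : g ≤ (D.step^[n] σ).row) :
    ∃ j < n, (D.step^[j] σ).top = true ∧ (D.step^[j] σ).up = true ∧ (D.step^[j] σ).ht = g := by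
  induction n with
  | zero => exact absurd h₁ (not_le.2 h₀)
  | succ n ih =>
    rcases lt_or_ge (D.step^[n] σ).row g with h₂ | h₂
    · rw [Function.iterate_succ_apply'] at h₁
      have h₃ : (D.step^[n] σ).top = true ∧ (D.step^[n] σ).up = true := by
        by_contra h₃
        exact absurd (row_step_le (D := D) h₃) (by linarith)
      have h₄ := row_step_of_top_up (D := D) h₃.1 h₃.2
      refine ⟨n, n.lt_succ_self, h₃.1, h₃.2, ?_⟩
      have h₅ : (D.step^[n] σ).row = (D.step^[n] σ).ht - 1 := by simp [CState.row, h₃.1]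
      omega
    · obtain ⟨j, hj, h⟩ := ih h₂
      exact ⟨j, hj.trans n.lt_succ_self, h⟩

/-- After `n` steps the lift of `β` meets the lift of `α` through `σ` again for the first
time. -/
structure FirstReturn (D : StdDiagram) (σ : CState) (n : ℕ) : Prop where
  pos : 0 < n
  top : (D.step^[n] σ).top = true
  ht : (D.step^[n] σ).ht = σ.ht
  not_mem : ∀ i, 0 < i → i < n → ¬ ((D.step^[i] σ).top = true ∧ (D.step^[i] σ).ht = σ.ht)

theorem FirstReturn.unique {σ : CState} {m n : ℕ} (hm : D.FirstReturn σ m)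
    (hn : D.FirstReturn σ n) : m = n := by
  rcases lt_trichotomy m n with h | h | h
  · exact (hn.not_mem m hm.pos h ⟨hm.top, hm.ht⟩).elim
  · exact h
  · exact (hm.not_mem n hn.pos h ⟨hn.top, hn.ht⟩).elim

theorem exists_firstReturn {σ : CState} {n : ℕ} (hn : 0 < n)
    (ht : (D.step^[n] σ).top = true) (hh : (D.step^[n] σ).ht = σ.ht) :
    ∃ m ≤ n, D.FirstReturn σ m := by
  have H : ∃ m, 0 < m ∧ (D.step^[m] σ).top = true ∧ (D.step^[m] σ).ht = σ.ht := ⟨n, hn, ht, hh⟩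
  obtain ⟨h₁, h₂, h₃⟩ := Nat.find_spec H
  exact ⟨Nat.find H, Nat.find_le ⟨hn, ht, hh⟩, h₁, h₂, h₃, fun i h₀ hi h =>
    Nat.find_min H hi ⟨h₀, h⟩⟩

theorem firstReturn_shift (m h : ℤ) {σ : CState} {n : ℕ} :
    D.FirstReturn (D.shift m h σ) n ↔ D.FirstReturn σ n := by
  constructor <;> rintro ⟨h₁, h₂, h₃, h₄⟩ <;> refine ⟨h₁, ?_, ?_, ?_⟩ <;>
    simp_all [iterate_step_shift]

theorem FirstReturn.row_lt {σ : CState} {n : ℕ} (hn : D.FirstReturn σ n) (ht : σ.top = true)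
    (hu : σ.up = false) {i : ℕ} (hi : i ≤ n) : (D.step^[i] σ).row < σ.ht := by
  by_contra! h
  have h₀ : σ.row < σ.ht := by simp [CState.row, ht]
  obtain ⟨j, hj, h₁, h₂, h₃⟩ := exists_upward_crossing h₀ h
  rcases j.eq_zero_or_pos with rfl | hj₀
  · simp [hu] at h₂
  · exact hn.not_mem j hj₀ (by omega) ⟨h₁, h₃⟩

theorem FirstReturn.up_of_down {σ : CState} {n : ℕ} (hn : D.FirstReturn σ n)
    (ht : σ.top = true) (hu : σ.up = false) : (D.step^[n] σ).up = true := by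
  by_contra h
  obtain ⟨k, rfl⟩ : ∃ k, n = k + 1 := ⟨n - 1, by have := hn.pos; omega⟩
  have h₁ := hn.row_lt ht hu (i := k) (by omega)
  have h₂ := hn.top
  have h₃ := hn.ht
  rw [Function.iterate_succ_apply'] at h h₂ h₃
  rw [row_of_step_top_down h₂ (by simpa using h), h₃] at h₁
  exact lt_irrefl _ h₁

theorem step_iterate_rev {i n : ℕ} (hi : i ≤ n) (σ : CState) :
    D.step^[i] (D.step^[n] σ).rev = (D.step^[n - i] σ).rev := by
  conv_lhs => rw [← Nat.add_sub_cancel' hi, Function.iterate_add_apply]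
  exact step_iterate_rev_step_iterate i _

theorem FirstReturn.rev {σ : CState} {n : ℕ} (hn : D.FirstReturn σ n) (ht : σ.top = true) :
    D.FirstReturn (D.step^[n] σ).rev n := by
  refine ⟨hn.pos, ?_, ?_, fun i h₀ hi => ?_⟩
  · rw [step_iterate_rev le_rfl]; simpa using ht
  · rw [step_iterate_rev le_rfl]; simpa using hn.ht.symm
  · rw [step_iterate_rev hi.le]
    simpa [hn.ht] using hn.not_mem (n - i) (by omega) (by omega)

theorem FirstReturn.down_of_up {σ : CState} {n : ℕ} (hn : D.FirstReturn σ n)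
    (ht : σ.top = true) (hu : σ.up = true) : (D.step^[n] σ).up = false := by
  by_contra h
  have := (hn.rev ht).up_of_down hn.top (by simpa using h)
  rw [step_iterate_rev le_rfl] at this
  simp [hu] at this

/-! ### Arcs in the upper and in the lower half-plane -/

/-- The lift of `β` through the crossing `k` of `α̃` returns to `α̃`. -/
def Returns (D : StdDiagram) (E : ℤ → Bool) (k : ℤ) : Prop := ∃ n, D.FirstReturn (base E k) n

theorem returns0_iff (k : ℕ) : D.Returns0 (D.spt k) ↔ D.Returns D.orient k := by
  constructor
  · rintro ⟨n, hn, h⟩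
    rw [isCross0_iterate_fstep_spt] at h
    obtain ⟨m, -, hm⟩ := exists_firstReturn (σ := base D.orient k) hn h.1 h.2
    exact ⟨m, hm⟩
  · rintro ⟨n, hn⟩
    refine ⟨n, hn.pos, ?_⟩
    rw [isCross0_iterate_fstep_spt]
    exact ⟨hn.top, hn.ht⟩

theorem arcRight_iff {k n : ℕ} (hn : D.FirstReturn (base D.orient k) n) :
    D.ArcRight k ↔ (k : ℤ) < (D.step^[n] (base D.orient k)).pos := by
  have hmem : n ∈ {n : ℕ | 1 ≤ n ∧ IsCross0 (D.fstep^[n] (D.spt k))} := by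
    refine ⟨hn.pos, ?_⟩
    rw [isCross0_iterate_fstep_spt]
    exact ⟨hn.top, hn.ht⟩
  have h : D.ret0Steps (D.spt k) = n := by
    refine le_antisymm (Nat.sInf_le hmem) ?_
    obtain ⟨h₁, h₂⟩ := Nat.sInf_mem ⟨n, hmem⟩
    rw [isCross0_iterate_fstep_spt] at h₂
    by_contra! h₃
    exact hn.not_mem _ h₁ h₃ h₂
  rw [ArcRight, nxt0, h, pos_iterate_fstep_spt]

theorem returns_of_down (hE : D.IsOrientation E) (hd : 0 < D.degree E) {k : ℤ}
    (hk : E k = false) : D.Returns E k := by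
  obtain ⟨N, -, e⟩ := exists_common_period hE hd
  have hrow : ∀ h, (D.shift (-D.slope E) h (base E k)).row = h - 1 := by
    intro h; simp [CState.row, base, StdDiagram.shift]
  obtain ⟨j, -, h₁, h₂, h₃⟩ := exists_upward_crossing (D := D) (σ := base E k) (n := N) (g := 0)
    (by simp [CState.row, base]) (by rw [e _ (compat_base k), hrow]; omega)
  have hj : 0 < j := by
    rcases j.eq_zero_or_pos with rfl | hj
    · simp [base, hk] at h₂
    · exact hj
  obtain ⟨m, -, hm⟩ := exists_firstReturn hj h₁ h₃
  exact ⟨m, hm⟩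

/-- Every downward crossing is the end of an arc in the upper half-plane. -/
theorem exists_upper_arc (hE : D.IsOrientation E) (hd : 0 < D.degree E) {k : ℤ}
    (hk : E k = false) : ∃ a : ℤ, 0 ≤ a ∧ a < D.pz ∧ E a = true ∧ ∃ n m,
      D.FirstReturn (base E a) n ∧ D.step^[n] (base E a) = D.shift m 0 (base E k) := by
  have hp := D.pz_pos
  obtain ⟨N, hN, e⟩ := exists_common_period hE hd
  set σ := D.shift (D.slope E) (-D.degree E) (base E k) with hσ
  have hcσ : D.Compat E σ := (compat_shift hE _ _ _).2 (compat_base k)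
  have heσ : D.step^[N] σ = base E k := by
    rw [e σ hcσ, hσ, shift_shift]; simp [shift_zero]
  have h₁ : σ.row < 0 := by
    have : σ.row = -D.degree E - 1 := by simp [CState.row, base, hσ, StdDiagram.shift]
    omega
  have h₂ : (D.step^[N - 1] σ).row = 0 := by
    have h : D.step (D.step^[N - 1] σ) = base E k := by
      rw [← Function.iterate_succ_apply' (f := D.step), Nat.succ_eq_add_one, Nat.sub_add_cancel hN,
        heσ]
    have := row_of_step_top_down (D := D) (σ := D.step^[N - 1] σ) (by rw [h]; rfl)
      (by rw [h]; exact hk)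
    rw [this, h]; rfl
  obtain ⟨i, hi, h₃, -, h₅⟩ := exists_upward_crossing h₁ h₂.ge
  let P : ℕ → Prop := fun j => (D.step^[j] σ).top = true ∧ (D.step^[j] σ).ht = 0
  let j := Nat.findGreatest P (N - 1)
  have hj : P j := Nat.findGreatest_spec (P := P) hi.le ⟨h₃, h₅⟩
  have hjN : j ≤ N - 1 := Nat.findGreatest_le _
  set τ := D.step^[j] σ with hτ
  have hcτ : D.Compat E τ := (compat_iterate_step hE j σ).2 hcσ
  have hit : ∀ i, D.step^[i] τ = D.step^[i + j] σ := fun i =>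
    (Function.iterate_add_apply _ _ _ _).symm
  have hend : D.step^[N - j] τ = base E k := by
    rw [hit, Nat.sub_add_cancel (by omega), heσ]
  have hfr : D.FirstReturn τ (N - j) := by
    refine ⟨by omega, by rw [hend]; rfl, by rw [hend, hj.2]; rfl, fun i h₀ hi h => ?_⟩
    rw [hit, hj.2] at h
    exact Nat.findGreatest_is_greatest (P := P) (n := N - 1) (k := i + j)
      (by change j < _; omega) (by omega) h
  have hup : τ.up = true := by
    by_contra h
    have := hfr.up_of_down hj.1 (by simpa using h)
    rw [hend] at this
    simp [base, hk] at this
  obtain ⟨m, hm⟩ := hcτ.eq_shift_base hE hj.1 (k := τ.pos % D.pz)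
    (Int.emod_emod_of_dvd _ dvd_rfl).symm
  rw [hj.2] at hm
  refine ⟨τ.pos % D.pz, Int.emod_nonneg _ hp.ne', Int.emod_lt_of_pos _ hp, ?_, N - j, -m, ?_, ?_⟩
  · rw [hm] at hup; exact hup
  · rw [hm, firstReturn_shift] at hfr; exact hfr
  · rw [hm, iterate_step_shift] at hend
    rw [← hend, shift_shift]; simp [shift_zero]

theorem label_unique_of_upper_arcs {a b : ℤ} {n n' : ℕ}
    {m : ℤ} (hn : D.FirstReturn (base E a) n) (hn' : D.FirstReturn (base E b) n')
    (e : D.step^[n] (base E a) = D.shift m 0 (D.step^[n'] (base E b))) :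
    a % D.pz = b % D.pz := by
  suffices H : ∀ a b m n n', 0 < n → n ≤ n' → D.FirstReturn (base E b) n' →
      D.step^[n] (base E a) = D.shift m 0 (D.step^[n'] (base E b)) → a % D.pz = b % D.pz by
    rcases le_total n n' with h | h
    · exact H a b m n n' hn.pos h hn' e
    · refine (H b a (-m) n' n hn'.pos h hn ?_).symm
      rw [e, shift_shift]; simp [shift_zero]
  clear! a b m n n'
  intro a b m n n' hn₀ hle hn' e
  have e' : base E a = D.shift m 0 (D.step^[n' - n] (base E b)) := by
    apply step_injective.iterate n
    rw [e, iterate_step_shift, ← Function.iterate_add_apply, Nat.add_sub_cancel' hle]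
  rcases hle.eq_or_lt with rfl | hlt
  · rw [Nat.sub_self, Function.iterate_zero_apply] at e'
    have : a = b + D.pz * m := congrArg CState.pos e'
    rw [this, Int.add_mul_emod_self_left]
  · have h₁ : true = (D.step^[n' - n] (base E b)).top := congrArg CState.top e'
    have h₂ : 0 = (D.step^[n' - n] (base E b)).ht + 0 := congrArg CState.ht e'
    exact (hn'.not_mem _ (by omega) (by omega) ⟨h₁.symm, by rw [add_zero] at h₂; exact h₂.symm⟩).elim

/-! ### Counting arcs of one lift -/

/-- The intersection points of a class at which an arc in the upper (`u = true`) or lower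
(`u = false`) half-plane starts. -/
def classStarts (D : StdDiagram) (E : ℤ → Bool) (l : ℤ) (u : Bool) : Finset ℕ :=
  (Finset.range D.p).filter fun a =>
    D.level E (base E a) ≡ l [ZMOD D.degree E] ∧ D.Returns E a ∧ E a = u

/-- The arc starting at `a` ends at `k`. -/
def ArcTo (D : StdDiagram) (E : ℤ → Bool) (a k : ℤ) : Prop :=
  ∃ n m, D.FirstReturn (base E a) n ∧ D.step^[n] (base E a) = D.shift m 0 (base E k)

theorem eq_of_emod_eq {a b : ℕ} (ha : a < D.p) (hb : b < D.p)
    (h : (a : ℤ) % D.pz = (b : ℤ) % D.pz) : a = b := by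
  have hpz : D.pz = (D.p : ℤ) := rfl
  rw [Int.emod_eq_of_lt (by omega) (by omega), Int.emod_eq_of_lt (by omega) (by omega)] at h
  exact_mod_cast h

theorem ArcTo.level (hE : D.IsOrientation E) {a k : ℤ} (h : D.ArcTo E a k) :
    D.level E (base E a) ≡ D.level E (base E k) [ZMOD D.degree E] := by
  obtain ⟨n, m, -, e⟩ := h
  have := level_iterate_step hE n (base E a)
  rw [e, level_shift hE, mul_zero, add_zero] at this
  rw [← this]
  exact Int.modEq_iff_dvd.2 ⟨-m, by ring⟩

theorem ArcTo.left_unique {a b k : ℤ} (ha : D.ArcTo E a k) (hb : D.ArcTo E b k) :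
    a % D.pz = b % D.pz := by
  obtain ⟨n, m, h, e⟩ := ha
  obtain ⟨n', m', h', e'⟩ := hb
  refine label_unique_of_upper_arcs (m := m - m') h h' ?_
  rw [e, e', shift_shift]
  congr 1; ring

theorem ArcTo.right_unique {a k l : ℤ} (hk : D.ArcTo E a k) (hl : D.ArcTo E a l) :
    k % D.pz = l % D.pz := by
  obtain ⟨n, m, h, e⟩ := hk
  obtain ⟨n', m', h', e'⟩ := hl
  rw [h.unique h', e'] at e
  have : l + D.pz * m' = k + D.pz * m := congrArg CState.pos e
  rw [← Int.add_mul_emod_self_left k D.pz m, ← this, Int.add_mul_emod_self_left]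

theorem exists_arcTo_of_mem_upper (hE : D.IsOrientation E) (hd : 0 < D.degree E) {l : ℤ} {a : ℕ}
    (ha : a ∈ D.classStarts E l true) : ∃ k ∈ D.classStarts E l false, D.ArcTo E a k := by
  have hp := D.pz_pos
  simp only [classStarts, Finset.mem_filter, Finset.mem_range] at ha ⊢
  obtain ⟨-, hl, ⟨n, hn⟩, hup⟩ := ha
  set τ := D.step^[n] (base E a) with hτ
  have hcτ : D.Compat E τ := (compat_iterate_step hE n _).2 (compat_base _)
  have h₀ := Int.emod_nonneg τ.pos hp.ne'
  have h₁ := Int.emod_lt_of_pos τ.pos hp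
  have hk : ((τ.pos % D.pz).toNat : ℤ) = τ.pos % D.pz := Int.toNat_of_nonneg h₀
  obtain ⟨m, hm⟩ := hcτ.eq_shift_base hE hn.top (k := ((τ.pos % D.pz).toNat : ℤ))
    (by rw [hk, Int.emod_emod_of_dvd _ dvd_rfl])
  have h0 : τ.ht = 0 := hn.ht
  rw [h0] at hm
  have harc : D.ArcTo E a (τ.pos % D.pz).toNat := ⟨n, m, hn, hm⟩
  have hdown : E ((τ.pos % D.pz).toNat : ℤ) = false := by
    have := hn.down_of_up rfl hup
    rw [← hτ, hm] at this
    exact this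
  have hpz : D.pz = (D.p : ℤ) := rfl
  exact ⟨_, ⟨by omega, (harc.level hE).symm.trans hl, returns_of_down hE hd hdown, hdown⟩, harc⟩

theorem exists_arcTo_of_mem_lower (hE : D.IsOrientation E) (hd : 0 < D.degree E) {l : ℤ} {k : ℕ}
    (hk : k ∈ D.classStarts E l false) : ∃ a ∈ D.classStarts E l true, D.ArcTo E a k := by
  simp only [classStarts, Finset.mem_filter, Finset.mem_range] at hk ⊢
  obtain ⟨-, hl, -, hdown⟩ := hk
  obtain ⟨a, h₀, h₁, hup, n, m, hn, e⟩ := exists_upper_arc hE hd hdown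
  obtain ⟨b, rfl⟩ : ∃ b : ℕ, a = b := ⟨a.toNat, by omega⟩
  have harc : D.ArcTo E b k := ⟨n, m, hn, e⟩
  exact ⟨b, ⟨by rw [pz] at h₁; omega, (harc.level hE).trans hl, ⟨n, hn⟩, hup⟩, harc⟩

/-- A lift has as many compact arcs in the upper as in the lower half-plane. -/
theorem card_classStarts (hE : D.IsOrientation E) (hd : 0 < D.degree E) (l : ℤ) :
    (D.classStarts E l true).card = (D.classStarts E l false).card := by
  have hlt : ∀ {u a}, a ∈ D.classStarts E l u → a < D.p := fun h => by
    simpa using (Finset.mem_filter.1 h).1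
  have hU := fun a (ha : a ∈ D.classStarts E l true) => exists_arcTo_of_mem_upper hE hd ha
  have hL := fun k (hk : k ∈ D.classStarts E l false) => exists_arcTo_of_mem_lower hE hd hk
  choose! f hf hf' using hU
  choose! g hg hg' using hL
  refine le_antisymm (Finset.card_le_card_of_injOn f hf ?_)
    (Finset.card_le_card_of_injOn g hg ?_)
  · intro a ha b hb hab
    exact eq_of_emod_eq (hlt ha) (hlt hb) ((hf' a ha).left_unique (hab ▸ hf' b hb))
  · intro a ha b hb hab
    exact eq_of_emod_eq (hlt ha) (hlt hb) ((hg' a ha).right_unique (hab ▸ hg' b hb))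

/-! ### Arcs in the lower half-plane contain rainbow arcs -/

/-- The upper end of the vertical strand whose lower end is `y`. -/
def strand (D : StdDiagram) (y : ℤ) : ℤ :=
  if y % D.pz < D.rz + 2 * D.qz then y - 2 * D.qz else y

theorem exists_emod (D : StdDiagram) (x : ℤ) :
    ∃ m t, x = m + D.pz * t ∧ 0 ≤ m ∧ m < D.pz ∧ x % D.pz = m :=
  ⟨x % D.pz, x / D.pz, (Int.emod_add_mul_ediv _ _).symm, Int.emod_nonneg _ D.pz_pos.ne',
    Int.emod_lt_of_pos _ D.pz_pos, rfl⟩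

theorem strand_lt_strand {y y' : ℤ} (hy' : 2 * D.qz ≤ y' % D.pz)
    (h : y < y') : D.strand y < D.strand y' := by
  have := D.qz_nonneg
  obtain ⟨m, t, rfl, h₀, h₁, e⟩ := D.exists_emod y
  obtain ⟨m', t', rfl, h₀', h₁', e'⟩ := D.exists_emod y'
  rw [e'] at hy'
  rw [strand, strand, e, e']
  split_ifs with h₂ h₃ h₃
  · omega
  · omega
  · have hp := D.pz_pos
    have ht : t + 1 ≤ t' := by
      by_contra! ht
      nlinarith
    nlinarith
  · exact h

theorem strand_le_strand {y y' : ℤ} (hy' : 2 * D.qz ≤ y' % D.pz) (h : y ≤ y') :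
    D.strand y ≤ D.strand y' := by
  rcases h.eq_or_lt with rfl | h
  · exact le_rfl
  · exact (strand_lt_strand hy' h).le

theorem step_bot_up_strand {y : ℤ} (hy : 2 * D.qz ≤ y % D.pz) (h : ℤ) :
    D.step ⟨y, true, false, h⟩ = ⟨D.strand y, true, true, h + 1⟩ := by
  obtain ⟨m, t, rfl, h₀, h₁, e⟩ := D.exists_emod y
  rw [e] at hy
  rw [strand, e]
  split_ifs with h₂
  · rw [step_bot_up_left hy h₂]; congr 1; ring
  · rw [step_bot_up_right (by omega) h₁]

theorem step_top_down_strand {x : ℤ}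
    (hx : x % D.pz < D.rz ∨ D.rz + 2 * D.qz ≤ x % D.pz) (h : ℤ) :
    ∃ y, 2 * D.qz ≤ y % D.pz ∧ x = D.strand y ∧
      D.step ⟨x, false, true, h⟩ = ⟨y, false, false, h - 1⟩ := by
  have := D.qz_nonneg
  have := D.rz_nonneg
  have := D.two_qz_add_rz_le
  obtain ⟨m, t, rfl, h₀, h₁, e⟩ := D.exists_emod x
  rw [e] at hx
  rcases hx with hx | hx
  · have e' : (m + 2 * D.qz + D.pz * t) % D.pz = m + 2 * D.qz := emod_pz (by omega) (by omega) t
    refine ⟨m + 2 * D.qz + D.pz * t, by omega, ?_, step_top_down_left h₀ hx t h⟩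
    rw [strand, e', if_pos (by omega)]; ring
  · refine ⟨m + D.pz * t, by omega, ?_, step_top_down_right hx h₁ t h⟩
    rw [strand, e, if_neg (by omega)]

/-- The point `u` lies on the side of `y` determined by `b`. -/
def OnSide (b : Bool) (y u : ℤ) : Prop := if b then y < u else u ≤ y

/-- The arc of length `n` starting at `σ` points in the direction `b`. -/
def Points (D : StdDiagram) (b : Bool) (σ : CState) (n : ℕ) : Prop :=
  σ.pos < (D.step^[n] σ).pos ↔ b = true

theorem step_bot_up_rainbow {y u : ℤ} {b : Bool} (hu : u % D.pz < 2 * D.qz)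
    (hy : 2 * D.qz ≤ y % D.pz) (h : OnSide b y u) (g : ℤ) :
    ∃ u', OnSide b y u' ∧ D.step ⟨u, true, false, g⟩ = ⟨u', false, false, g⟩ := by
  have hp := D.pz_pos
  have := D.qz_nonneg
  obtain ⟨m, t, rfl, h₀, h₁, e⟩ := D.exists_emod u
  obtain ⟨m', t', rfl, h₀', h₁', e'⟩ := D.exists_emod y
  rw [e] at hu
  rw [e'] at hy
  refine ⟨_, ?_, step_bot_up_arc h₀ hu t g⟩
  cases b
  · simp only [OnSide, Bool.false_eq_true, reduceIte] at h ⊢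
    have ht : t ≤ t' := by
      by_contra! ht
      nlinarith
    nlinarith
  · simp only [OnSide, reduceIte] at h ⊢
    have ht : t' + 1 ≤ t := by
      by_contra! ht
      nlinarith
    nlinarith

/-- If all arcs below a lift of `α` which are traversed before the next higher lift of `α`
is reached point in the same direction, then the whole path moves in this direction. -/
theorem onSide_of_points (b : Bool) (y g : ℤ) (hy : 2 * D.qz ≤ y % D.pz) (N : ℕ) :
    ∀ σ : CState, σ.top = true → σ.up = false → σ.ht = g →
      (OnSide b y (σ.pos + D.sz) ∨ σ.pos + D.sz = y) →
      (D.step^[N] σ).top = true → (D.step^[N] σ).ht = g + 1 →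
      (∀ i < N, ¬ ((D.step^[i] σ).top = true ∧ (D.step^[i] σ).ht = g + 1)) →
      (∀ i n, (D.step^[i] σ).top = true → (D.step^[i] σ).up = false →
        D.FirstReturn (D.step^[i] σ) n → i + n < N → D.Points b (D.step^[i] σ) n) →
      ∃ u, OnSide b y u ∧ 2 * D.qz ≤ u % D.pz ∧ (D.step^[N] σ).pos = D.strand u := by
  induction N using Nat.strong_induction_on with
  | _ N ih =>
  intro σ ht hu hg hside htN hgN hfirst harcs
  have hrowN : (D.step^[N] σ).row = g := by simp [CState.row, htN, hgN]
  obtain ⟨j, hjN, hjt, hju, hjg⟩ := exists_upward_crossing (D := D) (σ := σ) (n := N) (g := g)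
    (by simp [CState.row, ht, hg]) hrowN.ge
  have hj₀ : 0 < j := by
    rcases j.eq_zero_or_pos with rfl | h
    · simp [hu] at hju
    · exact h
  obtain ⟨m, hmj, hm⟩ := exists_firstReturn hj₀ hjt (hjg.trans hg.symm)
  have hdir : D.Points b σ m := harcs 0 m ht hu hm (by omega)
  set x := (D.step^[m] σ).pos with hx
  have hm₀ : D.step^[m] σ = ⟨x, true, true, g⟩ := by
    ext
    · rfl
    · exact hm.up_of_down ht hu
    · exact hm.top
    · exact hm.ht.trans hg
  have hm₁ : D.step^[m + 1] σ = ⟨x + D.sz, true, false, g⟩ := by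
    rw [Function.iterate_succ_apply', hm₀, step_top_up]
  have hside' : OnSide b y (x + D.sz) := by
    rw [Points, ← hx] at hdir
    cases b <;> simp only [OnSide, Bool.false_eq_true, reduceIte, iff_false, iff_true] at * <;>
      omega
  have hN₁ : N ≠ m + 1 := by
    rintro rfl
    rw [hm₁] at htN
    simp at htN
  rcases lt_or_ge ((x + D.sz) % D.pz) (2 * D.qz) with hW | hW
  · obtain ⟨u, hu', eu⟩ := step_bot_up_rainbow hW hy hside' g
    have hm₂ : D.step^[m + 2] σ = ⟨u, false, false, g⟩ := by
      rw [Function.iterate_succ_apply', hm₁, eu]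
    have hm₃ : D.step^[m + 3] σ = ⟨u - D.sz, false, true, g⟩ := by
      rw [Function.iterate_succ_apply', hm₂, step_bot_down]
    have hN₂ : N ≠ m + 2 := by
      rintro rfl
      rw [hm₂] at htN
      simp at htN
    have hN₃ : N ≠ m + 3 := by
      rintro rfl
      rw [hm₃] at hgN
      simp at hgN
    obtain ⟨M, rfl⟩ : ∃ M, N = M + (m + 3) := ⟨N - (m + 3), by omega⟩
    have hit : ∀ i, D.step^[i] (D.step^[m + 3] σ) = D.step^[i + (m + 3)] σ := fun i =>
      (Function.iterate_add_apply _ _ _ _).symm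
    rw [← hit] at htN hgN ⊢
    refine ih M (by omega) (D.step^[m + 3] σ) (by rw [hm₃]) (by rw [hm₃]) (by rw [hm₃])
      (Or.inl (by rw [hm₃]; simpa using hu')) htN hgN (fun i hi => ?_) (fun i n => ?_)
    · rw [hit]; exact hfirst _ (by omega)
    · rw [hit]
      intro h₁ h₂ h₃ h₄
      exact harcs _ n h₁ h₂ h₃ (by omega)
  · have hm₂ : D.step^[m + 2] σ = ⟨D.strand (x + D.sz), true, true, g + 1⟩ := by
      rw [Function.iterate_succ_apply', hm₁, step_bot_up_strand hW]
    obtain rfl : N = m + 2 := by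
      by_contra hne
      refine hfirst (m + 2) (by omega) ?_
      rw [hm₂]
      exact ⟨rfl, rfl⟩
    exact ⟨x + D.sz, hside', hW, by rw [hm₂]⟩

/-- Every arc in a lower half-plane contains a rainbow arc around `z` pointing in the same
direction. -/
theorem exists_rainbow (b : Bool) (n : ℕ) : ∀ σ : CState, σ.top = true → σ.up = false →
    D.FirstReturn σ n → D.Points b σ n →
    ∃ i m, (D.step^[i] σ).top = true ∧ (D.step^[i] σ).up = false ∧
      D.FirstReturn (D.step^[i] σ) m ∧ D.Points b (D.step^[i] σ) m ∧
      D.rz ≤ (D.step^[i] σ).pos % D.pz ∧ (D.step^[i] σ).pos % D.pz < D.rz + 2 * D.qz := by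
  induction n using Nat.strong_induction_on with
  | _ n ih =>
  intro σ ht hu hn hdir
  by_cases hZ : D.rz ≤ σ.pos % D.pz ∧ σ.pos % D.pz < D.rz + 2 * D.qz
  · exact ⟨0, n, ht, hu, hn, hdir, hZ.1, hZ.2⟩
  by_contra hcon
  obtain ⟨y, hy, hxy, hs⟩ := step_top_down_strand (D := D) (x := σ.pos) (by omega) σ.ht
  have h₁ : D.step σ = ⟨y, false, false, σ.ht - 1⟩ := by
    rw [← hs]; congr 1; ext <;> simp [ht, hu]
  have h₂ : D.step^[2] σ = ⟨y - D.sz, false, true, σ.ht - 1⟩ := by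
    rw [Function.iterate_succ_apply', Function.iterate_one, h₁, step_bot_down]
  have hn₁ : n ≠ 1 := by
    rintro rfl
    have := hn.top
    rw [Function.iterate_one, h₁] at this
    simp at this
  have hn₂ : n ≠ 2 := by
    rintro rfl
    have := hn.ht
    rw [h₂] at this
    simp at this
  obtain ⟨N, rfl⟩ : ∃ N, n = N + 2 := ⟨n - 2, by have := hn.pos; omega⟩
  have hit : ∀ i, D.step^[i] (D.step^[2] σ) = D.step^[i + 2] σ := fun i =>
    (Function.iterate_add_apply _ _ _ _).symm
  obtain ⟨u, hu₁, hu₂, hu₃⟩ := onSide_of_points (D := D) (!b) y (σ.ht - 1) hy N (D.step^[2] σ)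
    (by rw [h₂]) (by rw [h₂]) (by rw [h₂]) (Or.inr (by rw [h₂]; simp))
    (by rw [hit]; exact hn.top) (by rw [hit, hn.ht]; ring)
    (fun i hi => by
      rw [hit, sub_add_cancel]
      exact hn.not_mem _ (by omega) (by omega))
    (fun i m h₃ h₄ h₅ h₆ => by
      by_contra h₇
      have h₈ : D.Points b (D.step^[i] (D.step^[2] σ)) m := by
        revert h₇; unfold Points; cases b <;> simp
      obtain ⟨i', m', hi'⟩ := ih m (by omega) _ h₃ h₄ h₅ h₈
      rw [hit, ← Function.iterate_add_apply] at hi'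
      exact hcon ⟨_, m', hi'⟩)
  rw [hit] at hu₃
  rw [Points, hu₃, hxy] at hdir
  cases b
  · simp only [OnSide, Bool.not_false, Bool.false_eq_true, reduceIte, iff_false] at hu₁ hdir
    exact hdir (strand_lt_strand hu₂ hu₁)
  · simp only [OnSide, Bool.not_true, Bool.false_eq_true, reduceIte, iff_true] at hu₁ hdir
    exact absurd hdir (not_lt.2 (strand_le_strand hy hu₁))

/-- An arc in the lower half-plane forces a foot of a rainbow arc around `z` at which `β`
runs downwards, on the left for an arc pointing to the right and vice versa. -/
theorem exists_foot (hE : D.IsOrientation E) {b : Bool} {k : ℤ} {n : ℕ} (hk : E k = false)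
    (hn : D.FirstReturn (base E k) n) (hb : D.Points b (base E k) n) :
    ∃ a, D.rz ≤ a ∧ a < D.rz + 2 * D.qz ∧ E a = false ∧ (a < D.rz + D.qz ↔ b = true) := by
  obtain ⟨i, m, ht, hu, hm, hdir, h₀, h₁⟩ := exists_rainbow b n _ rfl hk hn hb
  set τ := D.step^[i] (base E k) with hτ
  have hcτ : D.Compat E τ := (compat_iterate_step hE i _).2 (compat_base k)
  obtain ⟨a, t, hp, -, -, ha⟩ := D.exists_emod τ.pos
  rw [ha] at h₀ h₁
  have hstep : D.step τ = ⟨2 * D.rz + 2 * D.qz - 1 - a + D.pz * t, true, true, τ.ht⟩ := by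
    rw [← step_top_down_arc h₀ h₁]; congr 1; ext <;> simp [ht, hu, hp]
  obtain rfl : m = 1 := by
    refine hm.unique ⟨one_pos, ?_, ?_, fun i h₀ h₁ => by omega⟩ <;>
      rw [Function.iterate_one, hstep]
  refine ⟨a, h₀, h₁, ?_, ?_⟩
  · rw [← orientation_add_pz_mul hE a t, ← hp, ← hu, hcτ, crossing, if_pos ht]
  · rw [Points, Function.iterate_one, hstep, hp] at hdir
    rw [← hdir]
    constructor <;> intro <;> simp only at * <;> omega

/-! ### Feet of rainbow arcs around `z` -/

theorem firstReturn_foot {a : ℤ} (h₀ : D.rz ≤ a) (h₁ : a < D.rz + 2 * D.qz) (ha : E a = false) :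
    D.FirstReturn (base E a) 1 ∧
      (D.step^[1] (base E a)).pos = 2 * D.rz + 2 * D.qz - 1 - a := by
  have hs := step_top_down_arc h₀ h₁ 0 0
  rw [mul_zero, add_zero, add_zero] at hs
  have hb : base E a = ⟨a, false, true, 0⟩ := by rw [base, ha]
  rw [hb]
  refine ⟨⟨one_pos, ?_, ?_, fun i h₀ h₁ => by omega⟩, ?_⟩ <;> rw [Function.iterate_one, hs]

theorem arcRight_foot_iff {a : ℕ} (h₀ : D.rz ≤ a) (h₁ : (a : ℤ) < D.rz + 2 * D.qz)
    (ha : D.orient a = false) : D.ArcRight a ↔ (a : ℤ) < D.rz + D.qz := by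
  obtain ⟨h, e⟩ := firstReturn_foot h₀ h₁ ha
  rw [arcRight_iff h, e]
  omega

theorem exists_adjacent {lo hi i j : ℤ} (hi₀ : lo ≤ i) (hi₁ : i < hi) (hj₀ : lo ≤ j)
    (hj₁ : j < hi) (hE : E i ≠ E j) : ∃ m, lo ≤ m ∧ m + 1 < hi ∧ E m ≠ E (m + 1) := by
  by_contra! H
  have key : ∀ n : ℕ, lo + n < hi → E (lo + n) = E lo := by
    intro n
    induction n with
    | zero => simp
    | succ n ih =>
      intro hn
      push_cast at hn ⊢
      rw [← ih (by omega), ← add_assoc, H (lo + n) (by omega) (by omega)]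
  have hi := key (i - lo).toNat (by omega)
  have hj := key (j - lo).toNat (by omega)
  rw [Int.toNat_of_nonneg (by omega), add_sub_cancel] at hi hj
  exact hE (hi.trans hj.symm)

theorem level_base_of_down {k : ℤ} (hk : E k = false) :
    D.level E (base E k) = pot E (k + 1) := by
  simp [level, base, hk, crossing]

/-- Oppositely directed feet at distance one produce two arcs of the same lift which start at
feet of rainbow arcs and point in opposite directions. -/
theorem exists_opposite_feet (hE : D.IsOrientation E) {a b : ℤ} (ha₀ : D.rz ≤ a)
    (ha₁ : a < D.rz + D.qz) (ha : E a = false) (hb₀ : D.rz + D.qz ≤ b)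
    (hb₁ : b < D.rz + 2 * D.qz) (hb : E b = false) :
    ∃ i j : ℕ, D.rz ≤ i ∧ (i : ℤ) < D.rz + D.qz ∧ E i = false ∧
      D.rz + D.qz ≤ j ∧ (j : ℤ) < D.rz + 2 * D.qz ∧ E j = false ∧
      D.level E (base E i) = D.level E (base E j) := by
  have hr := D.rz_nonneg
  have hb' := orientation_top_arc hE (by omega) hb₁
  rw [hb] at hb'
  obtain ⟨m, h₀, h₁, h⟩ := exists_adjacent (E := E) ha₀ ha₁
    (j := 2 * D.rz + 2 * D.qz - 1 - b) (by omega) (by omega) (by rw [ha, hb']; simp)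
  have hq : m + 1 < D.rz + 2 * D.qz := by omega
  have hpot := pot_add_one (E := E) m
  have hpot' := pot_add_one (E := E) (m + 1)
  cases hm : E m
  · have hm' : E (m + 1) = true := by
      rw [hm] at h; simpa using h.symm
    have ho := orientation_top_arc hE (m := m + 1) (by omega) hq
    rw [hm'] at ho
    have hp := pot_top_arc hE (m := 2 * D.rz + 2 * D.qz - 1 - (m + 1)) (by omega) (by omega)
    refine ⟨m.toNat, (2 * D.rz + 2 * D.qz - 1 - (m + 1)).toNat, ?_⟩
    rw [Int.toNat_of_nonneg (by omega), Int.toNat_of_nonneg (by omega)]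
    refine ⟨h₀, by omega, hm, by omega, by omega, ho, ?_⟩
    rw [level_base_of_down hm, level_base_of_down ho, ← hp, sub_sub_cancel]
  · have hm' : E (m + 1) = false := by
      rw [hm] at h; simpa using h.symm
    have ho := orientation_top_arc hE (m := m) (by omega) (by omega)
    rw [hm] at ho
    have hp := pot_top_arc hE (m := 2 * D.rz + 2 * D.qz - 1 - m) (by omega) (by omega)
    refine ⟨(m + 1).toNat, (2 * D.rz + 2 * D.qz - 1 - m).toNat, ?_⟩
    rw [Int.toNat_of_nonneg (by omega), Int.toNat_of_nonneg (by omega)]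
    refine ⟨by omega, h₁, hm', by omega, by omega, ho, ?_⟩
    rw [level_base_of_down hm', level_base_of_down ho, ← hp, sub_sub_cancel, hpot', hpot,
      sgn_not (k := m + 1) (l := m) (by rw [hm, hm']; rfl)]
    ring

theorem mem_upperStarts {k : ℕ} :
    k ∈ D.UpperStarts ↔ k < D.p ∧ D.Returns D.orient k ∧ D.orient k = true := by
  rw [UpperStarts, Finset.mem_filter, Finset.mem_range, returns0_iff, trueUp_spt]

theorem mem_lowerStarts {k : ℕ} :
    k ∈ D.LowerStarts ↔ k < D.p ∧ D.Returns D.orient k ∧ D.orient k = false := by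
  rw [LowerStarts, Finset.mem_filter, Finset.mem_range, returns0_iff, trueUp_spt,
    Bool.not_eq_true]

theorem exists_foot_of_lCnt_pos (hE : D.IsOrientation D.orient) {b : Bool} (h : 0 < D.lCnt b) :
    ∃ a, D.rz ≤ a ∧ a < D.rz + 2 * D.qz ∧ D.orient a = false ∧
      (a < D.rz + D.qz ↔ b = true) := by
  obtain ⟨k, hk⟩ := Finset.card_pos.1 h
  rw [Finset.mem_filter, mem_lowerStarts] at hk
  obtain ⟨⟨-, ⟨n, hn⟩, hk⟩, hdir⟩ := hk
  rw [arcRight_iff hn] at hdir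
  exact exists_foot hE hk hn hdir

/-- If the lower half-plane contains arcs of both directions, then one lift contains two arcs
in the lower half-plane which point in different directions. -/
theorem exists_opposite_lowerStarts (hE : D.IsOrientation D.orient) {b : Bool}
    (h : 0 < D.lCnt b) (h' : 0 < D.lCnt (!b)) :
    ∃ i j : ℕ, i ∈ D.LowerStarts ∧ j ∈ D.LowerStarts ∧ (D.ArcRight i ↔ b = true) ∧
      ¬ (D.ArcRight j ↔ b = true) ∧
      D.level D.orient (base D.orient i) = D.level D.orient (base D.orient j) := by
  have hpz : D.pz = (D.p : ℤ) := rfl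
  have := D.two_qz_add_rz_le
  have hq := D.qz_nonneg
  have hfoot : ∀ {a : ℕ}, D.rz ≤ a → (a : ℤ) < D.rz + 2 * D.qz → D.orient a = false →
      a ∈ D.LowerStarts := fun h₀ h₁ ha =>
    mem_lowerStarts.2 ⟨by omega, ⟨1, (firstReturn_foot h₀ h₁ ha).1⟩, ha⟩
  obtain ⟨x, hx₀, hx₁, hx, hxb⟩ := exists_foot_of_lCnt_pos hE h
  obtain ⟨y, hy₀, hy₁, hy, hyb⟩ := exists_foot_of_lCnt_pos hE h'
  cases b
  · simp only [Bool.not_false, Bool.false_eq_true, iff_false, iff_true] at hxb hyb ⊢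
    obtain ⟨i, j, hi₀, hi₁, hi, hj₀, hj₁, hj, hij⟩ :=
      exists_opposite_feet hE hy₀ hyb hy (not_lt.1 hxb) hx₁ hx
    refine ⟨j, i, hfoot (by omega) hj₁ hj, hfoot hi₀ (by omega) hi, ?_, ?_, hij.symm⟩
    · rw [arcRight_foot_iff (by omega) hj₁ hj]; omega
    · rw [arcRight_foot_iff hi₀ (by omega) hi]; omega
  · simp only [Bool.not_true, Bool.false_eq_true, iff_false, iff_true] at hxb hyb ⊢
    obtain ⟨i, j, hi₀, hi₁, hi, hj₀, hj₁, hj, hij⟩ :=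
      exists_opposite_feet hE hx₀ hxb hx (not_lt.1 hyb) hy₁ hy
    refine ⟨i, j, hfoot hi₀ (by omega) hi, hfoot (by omega) hj₁ hj, ?_, ?_, hij⟩
    · rw [arcRight_foot_iff hi₀ (by omega) hi]; omega
    · rw [arcRight_foot_iff (by omega) hj₁ hj]; omega

end StdDiagram

/-- Lemma 3.8, the "corner case".  Let the standard (1,1) diagram
be virtually almost coherent, and let `c` represent the spin^c class whose lift
`β̃ₛ` contains the two inconsistent arcs.  Then in each of the upper and the lower
half-plane, the line `α̃` cuts `β̃ₛ` into at least two compact arcs. -/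
theorem exceptional_class_has_two_arcs_in_each_half_plane
    (D : StdDiagram) (hconn : D.Connected) (hA : D.algInt ≠ 0)
    (hvac : D.VirtuallyAlmostCoherent)
    (dU dL : Bool)
    (hadmU : D.uCnt dU ≤ D.uCnt (!dU)) (hadmL : D.lCnt dL ≤ D.lCnt (!dL))
    (htwo : D.uCnt dU + D.lCnt dL = 2)
    (c : ℕ) (hc : c < D.p)
    (hcontain : ∀ k : ℕ, D.InconsCoverArc dU dL k → D.SameClass k c) :
    2 ≤ ((Finset.range D.p).filter fun a =>
          D.SameClass a c ∧ D.Returns0 (D.spt a) ∧ D.TrueUp (D.spt a)).card ∧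
    2 ≤ ((Finset.range D.p).filter fun a =>
          D.SameClass a c ∧ D.Returns0 (D.spt a) ∧ ¬ D.TrueUp (D.spt a)).card := by
  have hE := StdDiagram.isOrientation_orient hconn
  have hd : 0 < D.degree D.orient := StdDiagram.sum_sgn_orient_pos hA
  set l := D.level D.orient (StdDiagram.base D.orient c)
  have hclass : ∀ k : ℕ, k < D.p → D.SameClass k c →
      D.level D.orient (StdDiagram.base D.orient k) ≡ l [ZMOD D.degree D.orient] :=
    fun k hk => (StdDiagram.sameClass_iff hE hd hk hc).1
  have hU : ((Finset.range D.p).filter fun a =>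
      D.SameClass a c ∧ D.Returns0 (D.spt a) ∧ D.TrueUp (D.spt a)) =
      D.classStarts D.orient l true :=
    Finset.filter_congr fun a ha => by
      rw [StdDiagram.sameClass_iff hE hd (Finset.mem_range.1 ha) hc, StdDiagram.returns0_iff,
        StdDiagram.trueUp_spt]
  have hL : ((Finset.range D.p).filter fun a =>
      D.SameClass a c ∧ D.Returns0 (D.spt a) ∧ ¬ D.TrueUp (D.spt a)) =
      D.classStarts D.orient l false :=
    Finset.filter_congr fun a ha => by
      rw [StdDiagram.sameClass_iff hE hd (Finset.mem_range.1 ha) hc, StdDiagram.returns0_iff,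
        StdDiagram.trueUp_spt, Bool.not_eq_true]
  rw [hU, hL, StdDiagram.card_classStarts hE hd, and_self]
  rcases (D.lCnt dL).eq_zero_or_pos with h | h
  · rw [← StdDiagram.card_classStarts hE hd, ← htwo, h, add_zero]
    refine Finset.card_le_card fun k hk => ?_
    obtain ⟨hk, hdir⟩ := Finset.mem_filter.1 hk
    have hkc := hcontain k (Or.inl ⟨hk, hdir⟩)
    rw [StdDiagram.mem_upperStarts] at hk
    exact Finset.mem_filter.2 ⟨Finset.mem_range.2 hk.1, hclass k hk.1 hkc, hk.2⟩
  · obtain ⟨i, j, hi, hj, hdi, hdj, hij⟩ :=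
      StdDiagram.exists_opposite_lowerStarts hE h (h.trans_le hadmL)
    have hic := hcontain i (Or.inr ⟨hi, hdi⟩)
    have hne : i ≠ j := by
      rintro rfl
      exact hdj hdi
    rw [StdDiagram.mem_lowerStarts] at hi hj
    have hil := hclass i hi.1 hic
    rw [← Finset.card_pair hne]
    refine Finset.card_le_card fun k hk => ?_
    rcases Finset.mem_insert.1 hk with rfl | hk
    · exact Finset.mem_filter.2 ⟨Finset.mem_range.2 hi.1, hil, hi.2⟩
    · obtain rfl := Finset.mem_singleton.1 hk
      exact Finset.mem_filter.2 ⟨Finset.mem_range.2 hj.1, hij ▸ hil, hj.2⟩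

end

end OneOneKnot
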